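/- arXiv:1010.1665 — 6 statements merged into one kernel-verified Lean document; each statement's English description precedes it below -/
import Mathlib

section
/- Let k ≥ 2, let (S,T) be a partition of {1,…,k} into two nonempty sets, and for each nonempty L ⊆ {1,…,k} let M^L be a finite signed Borel measure on the product space (ℝ^d)^L. For nonempty disjoint S′,T′ ⊆ {1,…,k} define the cluster measure U^{S′,T′} := M^{S′∪T′} − M^{S′} ⊗ M^{T′} on (ℝ^d)^{S′∪T′}, and define the cumulant measure c^k := Σ_{L_1,…,L_p} (−1)^{p−1}(p−1)! M^{L_1} ⊗ ⋯ ⊗ M^{L_p}, the sum ranging over all unordered partitions of {1,…,k} into nonempty blocks (each product measure regarded as a measure on (ℝ^d)^k via the natural reindexing). Then there exist real coefficients a_{S′,T′;K_1,…,K_s}, indexed by partitions S′,T′,K_1,…,K_s of {1,…,k} with S′ ⊆ S nonempty and T′ ⊆ T nonempty, such that c^k = Σ a_{S′,T′;K_1,…,K_s} · U^{S′,T′} ⊗ M^{K_1} ⊗ ⋯ ⊗ M^{K_s} and Σ |a_{S′,T′;K_1,…,K_s}| ≤ k^k. -/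
open Finset MeasureTheory

/-- `P` is an (unordered) partition of `{1,…,k}` (i.e. of `Fin k`) into nonempty blocks. -/
def IsPartitionOfFin {k : ℕ} (P : Finset (Finset (Fin k))) : Prop :=
  (∀ B ∈ P, B.Nonempty) ∧ (∀ B ∈ P, ∀ B' ∈ P, B ≠ B' → Disjoint B B') ∧
    P.sup id = Finset.univ

instance {k : ℕ} : DecidablePred (IsPartitionOfFin (k := k)) := fun _ => by
  unfold IsPartitionOfFin; infer_instance

/-- The measurable rectangle `{x ∈ (ℝ^d)^L : x_i ∈ A_i for all i ∈ L}` in `(ℝ^d)^L`. -/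
def finRect {d k : ℕ} (L : Finset (Fin k)) (A : Fin k → Set (Fin d → ℝ)) :
    Set ((i : L) → (Fin d → ℝ)) :=
  Set.univ.pi fun i : L => A i.1

section FiberSums

variable {E : Type*} [Fintype E] [DecidableEq E]

/-- The colouring of `E` that gives every point the colour of its block. -/
def colouringOfEmbedding {β : Type*} (x : Σ π : Finpartition (univ : Finset E), π.parts ↪ β) :
    E → β :=
  fun y => x.2 ⟨x.1.part y, x.1.part_mem.2 (mem_univ y)⟩

lemma colouringOfEmbedding_eq_iff {β : Type*}
    (x : Σ π : Finpartition (univ : Finset E), π.parts ↪ β) (y z : E) :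
    colouringOfEmbedding x y = colouringOfEmbedding x z ↔ y ∈ x.1.part z := by
  unfold colouringOfEmbedding
  rw [x.2.injective.eq_iff, Subtype.mk.injEq,
    x.1.mem_part_iff_part_eq_part (mem_univ y) (mem_univ z)]

lemma colouringOfEmbedding_eq_apply_iff {β : Type*}
    (x : Σ π : Finpartition (univ : Finset E), π.parts ↪ β) (B : x.1.parts) (y : E) :
    colouringOfEmbedding x y = x.2 B ↔ y ∈ B.1 := by
  unfold colouringOfEmbedding
  rw [x.2.injective.eq_iff, Subtype.ext_iff]
  constructor
  · rintro h
    rw [← h]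
    exact x.1.mem_part (mem_univ y)
  · intro h
    exact x.1.part_eq_of_mem B.2 h

lemma colouringOfEmbedding_bijective {β : Type*} :
    Function.Bijective (colouringOfEmbedding (E := E) (β := β)) := by
  classical
  constructor
  · rintro ⟨π, e⟩ ⟨π', e'⟩ h
    have hpart : ∀ y, π.part y = π'.part y := by
      intro y
      ext z
      rw [← colouringOfEmbedding_eq_iff ⟨π, e⟩, ← colouringOfEmbedding_eq_iff ⟨π', e'⟩, h]
    have hparts : π = π' := by
      have key : ∀ ρ ρ' : Finpartition (univ : Finset E), (∀ y, ρ.part y = ρ'.part y) →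
          ρ.parts ⊆ ρ'.parts := by
        intro ρ ρ' hρ B hB
        obtain ⟨y, hy⟩ := ρ.nonempty_of_mem_parts hB
        rw [← ρ.part_eq_of_mem hB hy, hρ y]
        exact ρ'.part_mem.2 (mem_univ y)
      exact Finpartition.ext
        (Subset.antisymm (key _ _ hpart) (key _ _ fun y => (hpart y).symm))
    subst hparts
    congr 1
    ext B
    obtain ⟨y, hy⟩ := π.nonempty_of_mem_parts B.2
    rw [← (colouringOfEmbedding_eq_apply_iff ⟨π, e⟩ B y).2 hy, h]
    exact (colouringOfEmbedding_eq_apply_iff ⟨π, e'⟩ B y).2 hy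
  · intro f
    let π : Finpartition (univ : Finset E) := Finpartition.ofSetoid (Setoid.ker f)
    have hπ : ∀ y z, z ∈ π.part y ↔ f y = f z := fun y z =>
      Finpartition.mem_part_ofSetoid_iff_rel
    let r : π.parts → E := fun B => (π.nonempty_of_mem_parts B.2).choose
    have hr : ∀ B : π.parts, r B ∈ B.1 := fun B => (π.nonempty_of_mem_parts B.2).choose_spec
    refine ⟨⟨π, fun B => f (r B), ?_⟩, ?_⟩
    · intro B B' h
      have h' := (hπ (r B) (r B')).2 h
      rw [π.part_eq_of_mem B.2 (hr B)] at h'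
      exact Subtype.ext (π.eq_of_mem_parts B.2 B'.2 h' (hr B'))
    · funext y
      exact ((hπ y _).1 (hr ⟨π.part y, π.part_mem.2 (mem_univ y)⟩)).symm

lemma sum_prod_fibers_eq (n : ℕ) (g : Finset E → ℝ) (hg : g ∅ = 1) :
    ∑ f : E → Fin n, ∏ i, g {y | f y = i} =
      ∑ π : Finpartition (univ : Finset E),
        (n.descFactorial π.parts.card : ℝ) * ∏ B ∈ π.parts, g B := by
  classical
  have h : ∀ x : Σ π : Finpartition (univ : Finset E), π.parts ↪ Fin n,
      ∏ B ∈ x.1.parts, g B = ∏ i, g {y | colouringOfEmbedding x y = i} := by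
    intro x
    rw [← prod_coe_sort]
    refine Fintype.prod_of_injective x.2 x.2.injective _ _ ?_ ?_
    · intro i hi
      rw [filter_eq_empty_iff.2, hg]
      rintro y - rfl
      exact hi ⟨_, rfl⟩
    · intro B
      congr 1
      ext y
      simp [colouringOfEmbedding_eq_apply_iff]
  rw [← Fintype.sum_bijective _ colouringOfEmbedding_bijective _ _ h, Fintype.sum_sigma]
  refine sum_congr rfl fun π _ => ?_
  simp [Fintype.card_embedding_eq]

/-- The polynomial whose value at `n` is the sum over all maps `E → Fin n` of the product of `g`
over the fibres. -/
noncomputable def fiberPoly (g : Finset E → ℝ) : Polynomial ℝ :=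
  ∑ π : Finpartition (univ : Finset E),
    Polynomial.C (∏ B ∈ π.parts, g B) * descPochhammer ℝ π.parts.card

lemma eval_fiberPoly (g : Finset E → ℝ) (hg : g ∅ = 1) (n : ℕ) :
    (fiberPoly g).eval (n : ℝ) = ∑ f : E → Fin n, ∏ i, g {y | f y = i} := by
  rw [sum_prod_fibers_eq n g hg, fiberPoly, Polynomial.eval_finsetSum]
  refine sum_congr rfl fun π _ => ?_
  rw [Polynomial.eval_mul, Polynomial.eval_C, descPochhammer_eval_eq_descFactorial, mul_comm]

lemma card_parts_pos [Nonempty E] (π : Finpartition (univ : Finset E)) : 0 < π.parts.card :=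
  card_pos.2 (π.parts_nonempty univ_nonempty.ne_empty)

lemma coeff_zero_fiberPoly [Nonempty E] (g : Finset E → ℝ) : (fiberPoly g).coeff 0 = 0 := by
  rw [fiberPoly, Polynomial.finsetSum_coeff]
  refine sum_eq_zero fun π _ => ?_
  obtain ⟨p, hp⟩ := Nat.exists_eq_succ_of_ne_zero (card_parts_pos π).ne'
  rw [hp, Nat.succ_eq_add_one, descPochhammer_succ_left]
  simp

lemma descPochhammer_eval_neg_one (n : ℕ) :
    (descPochhammer ℝ n).eval (-1) = (-1) ^ n * (n.factorial : ℝ) := by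
  induction n with
  | zero => simp
  | succ n ih =>
    rw [descPochhammer_succ_right, Polynomial.eval_mul, ih, Nat.factorial_succ]
    simp
    ring

lemma coeff_one_descPochhammer (n : ℕ) :
    (descPochhammer ℝ (n + 1)).coeff 1 = (-1) ^ n * (n.factorial : ℝ) := by
  rw [descPochhammer_succ_left, Polynomial.coeff_X_mul, Polynomial.coeff_zero_eq_eval_zero,
    Polynomial.eval_comp, ← descPochhammer_eval_neg_one]
  simp

lemma coeff_one_fiberPoly [Nonempty E] (g : Finset E → ℝ) :
    (fiberPoly g).coeff 1 = ∑ π : Finpartition (univ : Finset E),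
      (-1) ^ (π.parts.card - 1) * ((π.parts.card - 1).factorial : ℝ) * ∏ B ∈ π.parts, g B := by
  rw [fiberPoly, Polynomial.finsetSum_coeff]
  refine sum_congr rfl fun π _ => ?_
  obtain ⟨p, hp⟩ := Nat.exists_eq_succ_of_ne_zero (card_parts_pos π).ne'
  rw [Polynomial.coeff_C_mul, hp, Nat.succ_eq_add_one, coeff_one_descPochhammer]
  simp [mul_comm]

lemma fiberPoly_eq_mul (S : Finset E) (g : Finset E → ℝ) (hg : g ∅ = 1) :
    fiberPoly (fun B => g (B ∩ S) * g (B ∩ Sᶜ)) =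
      fiberPoly (fun B : Finset {x // x ∈ S} => g (B.map (Function.Embedding.subtype _))) *
      fiberPoly (fun B : Finset {x // x ∉ S} => g (B.map (Function.Embedding.subtype _))) := by
  refine Polynomial.eq_of_infinite_eval_eq _ _
    (Set.Infinite.mono ?_ (Set.infinite_range_of_injective (Nat.cast_injective (R := ℝ))))
  rintro _ ⟨n, rfl⟩
  rw [Set.mem_ofPred_eq, Polynomial.eval_mul, eval_fiberPoly _ (by simp [hg]),
    eval_fiberPoly _ (by simp [hg]), eval_fiberPoly _ (by simp [hg]), sum_mul_sum,
    ← Fintype.sum_prod_type']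
  refine Fintype.sum_equiv (Equiv.piEquivPiSubtypeProd (fun x => x ∈ S) _) _ _ fun f => ?_
  rw [prod_mul_distrib]
  congr 1 <;> refine prod_congr rfl fun i _ => congrArg g ?_ <;> ext y <;>
    simp [Equiv.piEquivPiSubtypeProd, and_comm]

lemma sum_moebius_mul_prod_inter_eq_zero (S : Finset E) (hS : S.Nonempty) (hSc : Sᶜ.Nonempty)
    (g : Finset E → ℝ) (hg : g ∅ = 1) :
    ∑ π : Finpartition (univ : Finset E),
      (-1) ^ (π.parts.card - 1) * ((π.parts.card - 1).factorial : ℝ) *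
        ∏ B ∈ π.parts, (g (B ∩ S) * g (B ∩ Sᶜ)) = 0 := by
  have : Nonempty E := ⟨hS.choose⟩
  have : Nonempty {x // x ∈ S} := ⟨⟨_, hS.choose_spec⟩⟩
  have : Nonempty {x // x ∉ S} := ⟨⟨_, mem_compl.1 hSc.choose_spec⟩⟩
  rw [← coeff_one_fiberPoly (fun B => g (B ∩ S) * g (B ∩ Sᶜ)), fiberPoly_eq_mul S g hg,
    Polynomial.coeff_mul, Nat.antidiagonal_succ]
  simp [coeff_zero_fiberPoly]

lemma sum_factorial_card_parts_le :
    ∑ π : Finpartition (univ : Finset E), (π.parts.card.factorial : ℝ) ≤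
      (Fintype.card E : ℝ) ^ Fintype.card E := by
  have h := sum_prod_fibers_eq (E := E) (Fintype.card E) (fun _ => 1) rfl
  simp only [prod_const_one, mul_one, sum_const, card_univ, Fintype.card_fun, Fintype.card_fin,
    nsmul_eq_mul, Nat.cast_pow] at h
  rw [h]
  refine sum_le_sum fun π _ => ?_
  have hcard : π.parts.card ≤ Fintype.card E := π.card_parts_le_card
  rw [Nat.descFactorial_eq_factorial_mul_choose]
  exact_mod_cast Nat.le_mul_of_pos_right _ (Nat.choose_pos hcard)

end FiberSums

lemma sum_filter_isPartitionOfFin {k : ℕ} (F : Finset (Finset (Fin k)) → ℝ) :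
    ∑ P ∈ univ.filter (IsPartitionOfFin (k := k)), F P =
      ∑ π : Finpartition (univ : Finset (Fin k)), F π.parts := by
  symm
  refine sum_bij (fun π _ => π.parts) ?_ (fun _ _ _ _ h => Finpartition.ext h) ?_ fun _ _ => rfl
  · intro π _
    exact mem_filter.2 ⟨mem_univ _, fun B hB => π.nonempty_of_mem_parts hB,
      fun B hB B' hB' h => π.disjoint hB hB' h, π.sup_parts⟩
  · intro P hP
    obtain ⟨-, hne, hd, hsup⟩ := mem_filter.1 hP
    refine ⟨⟨P, ?_, hsup, fun h => by simpa using hne _ h⟩, mem_univ _, rfl⟩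
    exact supIndep_iff_pairwiseDisjoint.2 fun B hB B' hB' h => hd B hB B' hB' h

section Clusters

variable {k : ℕ}

/-- The triples `(S', T', {K_1, …, K_s})` that index the cluster decomposition. -/
def IsClusterIndex (S T : Finset (Fin k))
    (j : Finset (Fin k) × Finset (Fin k) × Finset (Finset (Fin k))) : Prop :=
  j.1.Nonempty ∧ j.1 ⊆ S ∧ j.2.1.Nonempty ∧ j.2.1 ⊆ T ∧
    IsPartitionOfFin (insert j.1 (insert j.2.1 j.2.2)) ∧
    j.1 ∉ j.2.2 ∧ j.2.1 ∉ j.2.2 ∧ j.1 ≠ j.2.1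

instance (S T : Finset (Fin k)) : DecidablePred (IsClusterIndex S T) := fun _ => by
  unfold IsClusterIndex; infer_instance

/-- The product of a cluster factor with the remaining blocks. -/
def clusterTerm (m : Finset (Fin k) → ℝ)
    (j : Finset (Fin k) × Finset (Fin k) × Finset (Finset (Fin k))) : ℝ :=
  (m (j.1 ∪ j.2.1) - m j.1 * m j.2.1) * ∏ K ∈ j.2.2, m K

/-- `F` is a combination of cluster terms whose coefficients have total absolute value at most
`c`. -/
def HasClusterExpansion (S T : Finset (Fin k)) (c : ℝ) (F : (Finset (Fin k) → ℝ) → ℝ) : Prop :=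
  ∃ a : {j // IsClusterIndex S T j} → ℝ, ∑ j, |a j| ≤ c ∧
    ∀ m, F m = ∑ j, a j * clusterTerm m j.1

namespace HasClusterExpansion

variable {S T : Finset (Fin k)} {c c' : ℝ} {F F' : (Finset (Fin k) → ℝ) → ℝ}

lemma zero : HasClusterExpansion S T 0 fun _ => 0 :=
  ⟨0, by simp, by simp⟩

lemma add (h : HasClusterExpansion S T c F) (h' : HasClusterExpansion S T c' F') :
    HasClusterExpansion S T (c + c') fun m => F m + F' m := by
  obtain ⟨a, ha, hF⟩ := h
  obtain ⟨a', ha', hF'⟩ := h'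
  refine ⟨a + a', ?_, fun m => ?_⟩
  · calc ∑ j, |(a + a') j| ≤ ∑ j, (|a j| + |a' j|) := sum_le_sum fun j _ => abs_add_le _ _
      _ ≤ c + c' := by rw [sum_add_distrib]; exact add_le_add ha ha'
  · simp [hF, hF', add_mul, sum_add_distrib]

lemma const_mul (r : ℝ) (h : HasClusterExpansion S T c F) :
    HasClusterExpansion S T (|r| * c) fun m => r * F m := by
  obtain ⟨a, ha, hF⟩ := h
  refine ⟨fun j => r * a j, ?_, fun m => ?_⟩
  · simp_rw [abs_mul, ← mul_sum]
    exact mul_le_mul_of_nonneg_left ha (abs_nonneg r)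
  · simp [hF, mul_sum, mul_assoc]

lemma mono (hc : c ≤ c') (h : HasClusterExpansion S T c F) : HasClusterExpansion S T c' F := by
  obtain ⟨a, ha, hF⟩ := h
  exact ⟨a, ha.trans hc, hF⟩

lemma sum {κ : Type*} (s : Finset κ) (c : κ → ℝ) (F : κ → (Finset (Fin k) → ℝ) → ℝ)
    (h : ∀ i ∈ s, HasClusterExpansion S T (c i) (F i)) :
    HasClusterExpansion S T (∑ i ∈ s, c i) fun m => ∑ i ∈ s, F i m := by
  classical
  induction s using Finset.induction_on with
  | empty => simpa using zero
  | insert i s hi ih =>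
    simp_rw [sum_insert hi]
    exact (h i (mem_insert_self i s)).add (ih fun j hj => h j (mem_insert_of_mem hj))

lemma single {j : Finset (Fin k) × Finset (Fin k) × Finset (Finset (Fin k))}
    (hj : IsClusterIndex S T j) : HasClusterExpansion S T 1 fun m => clusterTerm m j := by
  refine ⟨Pi.single ⟨j, hj⟩ 1, ?_, fun m => ?_⟩
  · rw [sum_eq_single ⟨j, hj⟩] <;> simp +contextual
  · rw [sum_eq_single ⟨j, hj⟩] <;> simp +contextual

end HasClusterExpansion

/-- The function `m`, with its value at `∅` replaced by `1`. -/
def normalizeEmpty (m : Finset (Fin k) → ℝ) (L : Finset (Fin k)) : ℝ :=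
  if L = ∅ then 1 else m L

lemma normalizeEmpty_of_nonempty (m : Finset (Fin k) → ℝ) {L : Finset (Fin k)}
    (hL : L.Nonempty) : normalizeEmpty m L = m L :=
  if_neg hL.ne_empty

lemma IsPartitionOfFin.split {B C : Finset (Fin k)} {K : Finset (Finset (Fin k))}
    (h : IsPartitionOfFin (insert (B ∪ C) K)) (hBC : B ∪ C ∉ K) (hB : B.Nonempty)
    (hC : C.Nonempty) (hd : Disjoint B C) :
    IsPartitionOfFin (insert B (insert C K)) ∧ B ∉ K ∧ C ∉ K := by
  obtain ⟨hne, hdisj, hsup⟩ := h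
  have hK : ∀ L ∈ K, Disjoint B L ∧ Disjoint C L := fun L hL => by
    rw [← disjoint_union_left]
    exact hdisj _ (mem_insert_self _ _) _ (mem_insert_of_mem hL) fun h => hBC (h ▸ hL)
  refine ⟨⟨?_, ?_, ?_⟩, fun h => ?_, fun h => ?_⟩
  · intro L hL
    rcases mem_insert.1 hL with rfl | hL
    · exact hB
    rcases mem_insert.1 hL with rfl | hL
    · exact hC
    exact hne L (mem_insert_of_mem hL)
  · have hBL : ∀ L ∈ insert C K, Disjoint B L := fun L hL => by
      rcases mem_insert.1 hL with rfl | hL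
      exacts [hd, (hK L hL).1]
    have hCL : ∀ L ∈ insert B K, Disjoint C L := fun L hL => by
      rcases mem_insert.1 hL with rfl | hL
      exacts [hd.symm, (hK L hL).2]
    intro L hL L' hL' hLL'
    simp only [mem_insert] at hL hL' hBL hCL
    rcases hL with h | h | h
    · subst h
      exact hBL L' (hL'.resolve_left hLL'.symm)
    · subst h
      exact hCL L' (by tauto)
    · rcases hL' with h' | h' | h'
      · subst h'
        exact (hBL L (Or.inr h)).symm
      · subst h'
        exact (hCL L (Or.inr h)).symm
      · exact hdisj _ (mem_insert_of_mem h) _ (mem_insert_of_mem h') hLL'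
  · rw [← hsup, sup_insert, sup_insert, sup_insert, ← sup_assoc]
    rfl
  · exact hB.ne_empty (disjoint_self.1 (hK _ h).1)
  · exact hC.ne_empty (disjoint_self.1 (hK _ h).2)

/-- A block is mixed when it meets both `S` and its complement. -/
def IsMixed (S B : Finset (Fin k)) : Prop :=
  (B ∩ S).Nonempty ∧ (B ∩ Sᶜ).Nonempty

instance (S : Finset (Fin k)) : DecidablePred (IsMixed S) := fun _ => by
  unfold IsMixed; infer_instance

lemma normalizeEmpty_mul_of_not_isMixed (S : Finset (Fin k)) (m : Finset (Fin k) → ℝ)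
    {B : Finset (Fin k)} (hB : B.Nonempty) (h : ¬ IsMixed S B) :
    normalizeEmpty m (B ∩ S) * normalizeEmpty m (B ∩ Sᶜ) = m B := by
  have hu : B ∩ S ∪ B ∩ Sᶜ = B := by rw [← inter_union_distrib_left]; simp
  rw [IsMixed, not_and_or, not_nonempty_iff_eq_empty, not_nonempty_iff_eq_empty] at h
  rcases h with h | h <;> rw [h] at hu ⊢
  · rw [empty_union] at hu
    rw [hu, normalizeEmpty_of_nonempty m hB]
    simp [normalizeEmpty]
  · rw [union_empty] at hu
    rw [hu, normalizeEmpty_of_nonempty m hB]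
    simp [normalizeEmpty]

lemma hasClusterExpansion_prod_sub_prod_inter (S : Finset (Fin k))
    (P : Finset (Finset (Fin k))) (hP : IsPartitionOfFin P) :
    HasClusterExpansion S Sᶜ (P.filter (IsMixed S)).card fun m =>
      ∏ B ∈ P, m B - ∏ B ∈ P, (normalizeEmpty m (B ∩ S) * normalizeEmpty m (B ∩ Sᶜ)) := by
  induction hn : (P.filter (IsMixed S)).card generalizing P with
  | zero =>
    have hmix := filter_eq_empty_iff.1 (card_eq_zero.1 hn)
    have h : (fun m : Finset (Fin k) → ℝ => ∏ B ∈ P, m B -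
        ∏ B ∈ P, (normalizeEmpty m (B ∩ S) * normalizeEmpty m (B ∩ Sᶜ))) = fun _ => 0 := by
      funext m
      rw [prod_congr rfl fun B hB =>
        normalizeEmpty_mul_of_not_isMixed S m (hP.1 B hB) (hmix hB), sub_self]
    rw [h]
    simpa using HasClusterExpansion.zero
  | succ n ih =>
    obtain ⟨B, hB⟩ := card_pos.1 (show 0 < (P.filter (IsMixed S)).card by omega)
    obtain ⟨hBP, hBS, hBT⟩ := mem_filter.1 hB
    obtain ⟨K, hBK, rfl⟩ : ∃ K, B ∉ K ∧ insert B K = P :=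
      ⟨P.erase B, notMem_erase B P, insert_erase hBP⟩
    have hu : B ∩ S ∪ B ∩ Sᶜ = B := by rw [← inter_union_distrib_left]; simp
    have hd : Disjoint (B ∩ S) (B ∩ Sᶜ) :=
      disjoint_compl_right.mono inter_subset_right inter_subset_right
    have hne : B ∩ S ≠ B ∩ Sᶜ := hd.ne hBS.ne_empty
    obtain ⟨hP', hSK, hTK⟩ := IsPartitionOfFin.split (by rwa [hu]) (by rwa [hu]) hBS hBT hd
    have hS' : B ∩ S ∉ insert (B ∩ Sᶜ) K := by simp [hne, hSK]
    have hmS : ¬ IsMixed S (B ∩ S) := by simp [IsMixed, inter_assoc]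
    have hmT : ¬ IsMixed S (B ∩ Sᶜ) := by simp [IsMixed, inter_assoc, inter_comm Sᶜ]
    have hcard : ((insert (B ∩ S) (insert (B ∩ Sᶜ) K)).filter (IsMixed S)).card = n := by
      rw [filter_insert, if_neg hmS, filter_insert, if_neg hmT]
      rw [filter_insert, if_pos ⟨hBS, hBT⟩, card_insert_of_notMem (by simp [hBK])] at hn
      omega
    have hj : IsClusterIndex S Sᶜ (B ∩ S, B ∩ Sᶜ, K) :=
      ⟨hBS, inter_subset_right, hBT, inter_subset_right, hP', hSK, hTK, hne⟩
    have hsum := (ih _ hP' hcard).add (HasClusterExpansion.single hj)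
    rw [Nat.cast_succ]
    convert hsum using 2 with m
    rw [prod_insert hBK, prod_insert hBK, prod_insert hS', prod_insert hTK, prod_insert hS',
      prod_insert hTK, normalizeEmpty_mul_of_not_isMixed S m hBS hmS,
      normalizeEmpty_mul_of_not_isMixed S m hBT hmT, normalizeEmpty_of_nonempty m hBS,
      normalizeEmpty_of_nonempty m hBT, clusterTerm, hu]
    ring

lemma hasClusterExpansion_cumulant (S : Finset (Fin k)) (hS : S.Nonempty) (hSc : Sᶜ.Nonempty) :
    HasClusterExpansion S Sᶜ ((k : ℝ) ^ k) fun m =>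
      ∑ P ∈ univ.filter (IsPartitionOfFin (k := k)),
        (-1 : ℝ) ^ (P.card - 1) * (Nat.factorial (P.card - 1) : ℝ) * ∏ L ∈ P, m L := by
  have : Nonempty (Fin k) := ⟨hS.choose⟩
  have h := HasClusterExpansion.sum (univ.filter (IsPartitionOfFin (k := k))) _ _ fun P hP =>
    (hasClusterExpansion_prod_sub_prod_inter S P (mem_filter.1 hP).2).const_mul
      ((-1 : ℝ) ^ (P.card - 1) * (Nat.factorial (P.card - 1) : ℝ))
  have hF : ∀ m : Finset (Fin k) → ℝ, ∑ P ∈ univ.filter (IsPartitionOfFin (k := k)),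
      (-1 : ℝ) ^ (P.card - 1) * (Nat.factorial (P.card - 1) : ℝ) *
        ∏ B ∈ P, (normalizeEmpty m (B ∩ S) * normalizeEmpty m (B ∩ Sᶜ)) = 0 := fun m => by
    rw [sum_filter_isPartitionOfFin]
    exact sum_moebius_mul_prod_inter_eq_zero S hS hSc (normalizeEmpty m) (if_pos rfl)
  simp_rw [mul_sub, sum_sub_distrib, hF, sub_zero] at h
  refine h.mono ?_
  have hk := sum_factorial_card_parts_le (E := Fin k)
  rw [Fintype.card_fin] at hk
  refine le_trans ?_ hk
  rw [sum_filter_isPartitionOfFin fun P => |(-1 : ℝ) ^ (P.card - 1) *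
    (Nat.factorial (P.card - 1) : ℝ)| * ((P.filter (IsMixed S)).card : ℝ)]
  refine sum_le_sum fun π _ => ?_
  rw [abs_mul, abs_pow, abs_neg, abs_one, one_pow, one_mul, Nat.abs_cast,
    ← Nat.mul_factorial_pred (card_parts_pos π).ne', mul_comm]
  exact_mod_cast Nat.mul_le_mul_right _ (card_filter_le _ _)

end Clusters

/-- Lemma on the decomposition of cumulant measures into cluster measures (Lemma 3.1).

Let `k ≥ 2`, let `(S,T)` be a partition of `{1,…,k}` into two nonempty sets, and for each
nonempty `L ⊆ {1,…,k}` let `M^L` be a finite signed Borel measure on `(ℝ^d)^L`.  Since a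
finite signed measure on a product space is determined by its values on measurable
rectangles, products of the measures `M^L` over the blocks of a partition of `{1,…,k}`
(regarded, via the natural reindexing, as measures on `(ℝ^d)^k`) are faithfully encoded by
the corresponding products of rectangle values.  With
`c^k := Σ_{L_1,…,L_p} (−1)^{p−1} (p−1)! M^{L_1} ⊗ ⋯ ⊗ M^{L_p}` (sum over all unordered
partitions into nonempty blocks) and `U^{S′,T′} := M^{S′∪T′} − M^{S′} ⊗ M^{T′}`, there are
real coefficients `a_{S′,T′;K_1,…,K_s}`, indexed by partitions `S′,T′,K_1,…,K_s` of
`{1,…,k}` with `∅ ≠ S′ ⊆ S`, `∅ ≠ T′ ⊆ T`, such that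
`c^k = Σ a_{S′,T′;K_1,…,K_s} · U^{S′,T′} ⊗ M^{K_1} ⊗ ⋯ ⊗ M^{K_s}` and
`Σ |a_{S′,T′;K_1,…,K_s}| ≤ k^k`. -/
theorem stmt0 (d k : ℕ) (hd : 1 ≤ d) (hk : 2 ≤ k)
    (S T : Finset (Fin k)) (hS : S.Nonempty) (hT : T.Nonempty)
    (hST : Disjoint S T) (hSTuniv : S ∪ T = Finset.univ)
    (M : (L : Finset (Fin k)) → SignedMeasure ((i : L) → (Fin d → ℝ))) :
    ∃ (ι : Type) (_ : Fintype ι) (a : ι → ℝ)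
      (S' T' : ι → Finset (Fin k)) (Ks : ι → Finset (Finset (Fin k))),
      -- in each summand, `S', T', K_1, …, K_s` is a partition of `{1,…,k}`
      -- with `S' ⊆ S` and `T' ⊆ T` nonempty:
      (∀ j : ι, (S' j).Nonempty ∧ S' j ⊆ S ∧ (T' j).Nonempty ∧ T' j ⊆ T ∧
        IsPartitionOfFin (insert (S' j) (insert (T' j) (Ks j))) ∧
        S' j ∉ Ks j ∧ T' j ∉ Ks j ∧ S' j ≠ T' j) ∧
      -- the coefficients sum to at most `k^k` in absolute value:
      (∑ j : ι, |a j|) ≤ (k : ℝ) ^ k ∧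
      -- the identity of signed measures, tested on all measurable rectangles:
      (∀ A : Fin k → Set (Fin d → ℝ), (∀ i, MeasurableSet (A i)) →
        (∑ P ∈ Finset.univ.filter (IsPartitionOfFin (k := k)),
          (-1 : ℝ) ^ (P.card - 1) * (Nat.factorial (P.card - 1) : ℝ) *
            ∏ L ∈ P, M L (finRect L A))
        = ∑ j : ι, a j *
            ((M (S' j ∪ T' j) (finRect (S' j ∪ T' j) A)
                - M (S' j) (finRect (S' j) A) * M (T' j) (finRect (T' j) A)) *
              ∏ K ∈ Ks j, M K (finRect K A))) := by
  obtain rfl : T = Sᶜ := by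
    rw [eq_compl_iff_isCompl]
    exact ⟨hST.symm, codisjoint_iff.2 (by rwa [sup_comm])⟩
  obtain ⟨a, ha, hF⟩ := hasClusterExpansion_cumulant S hS hT
  exact ⟨{j // IsClusterIndex S Sᶜ j}, inferInstance, a, fun j => j.1.1, fun j => j.1.2.1,
    fun j => j.1.2.2, fun j => j.2, ha, fun A _ => hF fun L => M L (finRect L A)⟩
end

section
/- Let k ≥ 2 and let (S,T) be a partition of {1,…,k} into two nonempty sets. Let Z = {Z_1,…,Z_t} be an unordered partition of {1,…,k} into nonempty blocks such that each block Z_i is contained in S or in T. Then Σ_{L} (−1)^{|L|} (|L|−1)! = 0, where the sum ranges over all unordered partitions L = {L_1,…,L_p} of {1,…,k} into nonempty blocks such that the collection of all nonempty sets among {L_i ∩ S, L_i ∩ T : i = 1,…,p} equals exactly Z. -/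
open Finset

/-- The collection of all nonempty sets among `{L_i ∩ S, L_i ∩ T : L_i ∈ P}`. -/
def interTrace {k : ℕ} (S T : Finset (Fin k)) (P : Finset (Finset (Fin k))) :
    Finset (Finset (Fin k)) :=
  (P.image (· ∩ S) ∪ P.image (· ∩ T)).filter Finset.Nonempty

/-- The matchings between `A` and `B`, as sets of pairs. -/
def matchings {α β : Type*} [DecidableEq α] [DecidableEq β] (A : Finset α) (B : Finset β) :
    Finset (Finset (α × β)) :=
  (A ×ˢ B).powerset.filter fun M =>
    ∀ p ∈ M, ∀ q ∈ M, (p.1 = q.1 → p = q) ∧ (p.2 = q.2 → p = q)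

section Matchings

variable {α β : Type*} [DecidableEq α] [DecidableEq β] {A : Finset α} {B : Finset β}

lemma mem_matchings {M : Finset (α × β)} :
    M ∈ matchings A B ↔ (∀ p ∈ M, p.1 ∈ A ∧ p.2 ∈ B) ∧
      ∀ p ∈ M, ∀ q ∈ M, (p.1 = q.1 → p = q) ∧ (p.2 = q.2 → p = q) := by
  simp only [matchings, mem_filter, mem_powerset, subset_iff, mem_product]

lemma card_image_fst_of_mem_matchings {M : Finset (α × β)} (hM : M ∈ matchings A B) :
    (M.image Prod.fst).card = M.card :=
  card_image_of_injOn fun p hp q hq h => (((mem_matchings.1 hM).2 p hp q hq).1 h)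

lemma card_image_snd_of_mem_matchings {M : Finset (α × β)} (hM : M ∈ matchings A B) :
    (M.image Prod.snd).card = M.card :=
  card_image_of_injOn fun p hp q hq h => (((mem_matchings.1 hM).2 p hp q hq).2 h)

lemma image_fst_subset_of_mem_matchings {M : Finset (α × β)} (hM : M ∈ matchings A B) :
    M.image Prod.fst ⊆ A :=
  image_subset_iff.2 fun p hp => ((mem_matchings.1 hM).1 p hp).1

lemma image_snd_subset_of_mem_matchings {M : Finset (α × β)} (hM : M ∈ matchings A B) :
    M.image Prod.snd ⊆ B :=
  image_subset_iff.2 fun p hp => ((mem_matchings.1 hM).1 p hp).2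

/-- A matching of `insert x A` with `B` either leaves `x` unmatched or matches it with an
element of `B` not used by its restriction to `A`. -/
lemma sum_matchings_insert {x : α} (hx : x ∉ A) (f : ℕ → ℝ) :
    ∑ M ∈ matchings (insert x A) B, f M.card =
      ∑ M ∈ matchings A B, (f M.card + (B.card - M.card : ℝ) * f (M.card + 1)) := by
  have hfst : ∀ M ∈ matchings A B, ∀ p ∈ M, p.1 ≠ x := fun M hM p hp h =>
    hx (h ▸ ((mem_matchings.1 hM).1 p hp).1)
  have hunmatched : (matchings (insert x A) B).filter (fun M => ∀ p ∈ M, p.1 ≠ x) =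
      matchings A B := by
    ext M
    simp only [mem_filter]
    constructor
    · rintro ⟨hM, h⟩
      rw [mem_matchings] at hM ⊢
      refine ⟨fun p hp => ⟨?_, (hM.1 p hp).2⟩, hM.2⟩
      exact (mem_insert.1 (hM.1 p hp).1).resolve_left (h p hp)
    · intro hM
      refine ⟨?_, hfst M hM⟩
      rw [mem_matchings] at hM ⊢
      exact ⟨fun p hp => ⟨mem_insert_of_mem (hM.1 p hp).1, (hM.1 p hp).2⟩, hM.2⟩
  have hmatched : ∑ M ∈ (matchings (insert x A) B).filter (fun M => ¬ ∀ p ∈ M, p.1 ≠ x),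
      f M.card = ∑ N ∈ (matchings A B).sigma fun M => B \ M.image Prod.snd,
        f (N.1.card + 1) := by
    symm
    refine sum_bij (fun N _ => insert (x, N.2) N.1) ?_ ?_ ?_ ?_
    · rintro ⟨M, b⟩ h
      simp only [mem_sigma, mem_sdiff, mem_image, not_exists, not_and] at h
      have hf := hfst M h.1
      have hM := mem_matchings.1 h.1
      rw [mem_filter, mem_matchings]
      refine ⟨⟨?_, ?_⟩, fun h' => h' (x, b) (mem_insert_self _ _) rfl⟩
      · intro p hp
        rcases mem_insert.1 hp with rfl | hp
        · exact ⟨mem_insert_self _ _, h.2.1⟩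
        · exact ⟨mem_insert_of_mem (hM.1 p hp).1, (hM.1 p hp).2⟩
      · intro p hp q hq
        rcases mem_insert.1 hp with rfl | hp <;> rcases mem_insert.1 hq with rfl | hq
        · exact ⟨fun _ => rfl, fun _ => rfl⟩
        · exact ⟨fun e => (hf q hq e.symm).elim, fun e => (h.2.2 q hq e.symm).elim⟩
        · exact ⟨fun e => (hf p hp e).elim, fun e => (h.2.2 p hp e).elim⟩
        · exact hM.2 p hp q hq
    · rintro ⟨M, b⟩ h ⟨M', b'⟩ h' e
      simp only [mem_sigma] at h h'
      have hf := hfst M h.1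
      have hf' := hfst M' h'.1
      simp only [Finset.ext_iff, mem_insert] at e
      have hb : b = b' := by
        rcases (e (x, b)).1 (Or.inl rfl) with e | e
        · exact congrArg Prod.snd e
        · exact (hf' _ e rfl).elim
      subst hb
      have hMM : M = M' := by
        ext p
        have := e p
        by_cases hp : p = (x, b)
        · subst hp
          exact ⟨fun h => (hf _ h rfl).elim, fun h => (hf' _ h rfl).elim⟩
        · simpa [hp] using this
      subst hMM
      rfl
    · intro M hM
      rw [mem_filter, mem_matchings] at hM
      obtain ⟨⟨hAB, hinj⟩, hxM⟩ := hM
      push Not at hxM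
      obtain ⟨⟨y, b⟩, hp, rfl⟩ := hxM
      refine ⟨⟨M.erase (y, b), b⟩, ?_, insert_erase hp⟩
      simp only [mem_sigma, mem_sdiff, mem_matchings]
      refine ⟨⟨fun p hpM => ?_, fun p hpM q hq =>
        hinj p (mem_of_mem_erase hpM) q (mem_of_mem_erase hq)⟩, (hAB _ hp).2, ?_⟩
      · obtain ⟨hne, hpM⟩ := mem_erase.1 hpM
        refine ⟨(mem_insert.1 (hAB p hpM).1).resolve_left fun e => ?_, (hAB p hpM).2⟩
        exact hne ((hinj p hpM _ hp).1 e)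
      · intro hb
        obtain ⟨q, hq, e⟩ := mem_image.1 hb
        obtain ⟨hne, hq⟩ := mem_erase.1 hq
        exact hne ((hinj q hq _ hp).2 e)
    · rintro ⟨M, b⟩ h
      simp only [mem_sigma] at h
      rw [card_insert_of_notMem fun hp => hfst M h.1 _ hp rfl]
  rw [← sum_filter_add_sum_filter_not (matchings (insert x A) B) (fun M => ∀ p ∈ M, p.1 ≠ x),
    hunmatched, hmatched, sum_sigma, ← sum_add_distrib]
  refine sum_congr rfl fun M hM => ?_
  have hsub := image_snd_subset_of_mem_matchings hM
  have hcard := card_le_card hsub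
  rw [card_image_snd_of_mem_matchings hM] at hcard
  simp only [sum_const, nsmul_eq_mul, card_sdiff_of_subset hsub,
    card_image_snd_of_mem_matchings hM, Nat.cast_sub hcard]

lemma sum_matchings_neg_one_pow_mul_factorial (hA : A.Nonempty) (hB : B.Nonempty) :
    ∑ M ∈ matchings A B, (-1 : ℝ) ^ (A.card + B.card - M.card) *
      ((A.card + B.card - M.card - 1).factorial : ℝ) = 0 := by
  induction A using Finset.induction_on with
  | empty => exact absurd hA not_nonempty_empty
  | insert x A hx ih =>
    rw [sum_matchings_insert hx (fun j => (-1 : ℝ) ^ ((insert x A).card + B.card - j) *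
      (((insert x A).card + B.card - j - 1).factorial : ℝ)), card_insert_of_notMem hx]
    have hstep : ∀ M ∈ matchings A B,
        (-1 : ℝ) ^ (A.card + 1 + B.card - M.card) *
            ((A.card + 1 + B.card - M.card - 1).factorial : ℝ) +
          (B.card - M.card : ℝ) * ((-1 : ℝ) ^ (A.card + 1 + B.card - (M.card + 1)) *
            ((A.card + 1 + B.card - (M.card + 1) - 1).factorial : ℝ)) =
        -(A.card : ℝ) * ((-1 : ℝ) ^ (A.card + B.card - M.card) *
          ((A.card + B.card - M.card - 1).factorial : ℝ)) := by
      intro M hM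
      have hMA : M.card ≤ A.card := card_image_fst_of_mem_matchings hM ▸
        card_le_card (image_fst_subset_of_mem_matchings hM)
      have hB' := hB.card_pos
      obtain ⟨n, hn⟩ : ∃ n, A.card + B.card = n + 1 + M.card :=
        ⟨A.card + B.card - M.card - 1, by omega⟩
      have h1 : A.card + 1 + B.card - M.card = n + 2 := by omega
      have h2 : A.card + 1 + B.card - (M.card + 1) = n + 1 := by omega
      have h3 : A.card + B.card - M.card = n + 1 := by omega
      have hcast : (A.card + B.card : ℝ) = n + 1 + M.card := by exact_mod_cast hn
      have hBM : (B.card - M.card : ℝ) = n + 1 - A.card := by linarith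
      rw [h1, h2, h3, hBM, show n + 2 - 1 = n + 1 from rfl, show n + 1 - 1 = n from rfl,
        Nat.factorial_succ]
      push_cast
      ring
    rw [sum_congr rfl hstep, ← mul_sum]
    rcases A.eq_empty_or_nonempty with rfl | hA'
    · simp
    · rw [ih hA', mul_zero]

end Matchings

/-- The family obtained from `A ∪ B` by merging the pairs matched by `M`. -/
def mergePairs {α : Type*} [DecidableEq α] (A B : Finset (Finset α))
    (M : Finset (Finset α × Finset α)) : Finset (Finset α) :=
  (A \ M.image Prod.fst ∪ B \ M.image Prod.snd) ∪ M.image fun p => p.1 ∪ p.2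

section MergePairs

variable {α : Type*} [DecidableEq α] {S T : Finset α} {A B : Finset (Finset α)}
  {M : Finset (Finset α × Finset α)}

lemma mem_mergePairs {X : Finset α} :
    X ∈ mergePairs A B M ↔ (X ∈ A ∧ ∀ p ∈ M, p.1 ≠ X) ∨ (X ∈ B ∧ ∀ p ∈ M, p.2 ≠ X) ∨
      ∃ p ∈ M, p.1 ∪ p.2 = X := by
  simp only [mergePairs, mem_union, mem_sdiff, mem_image, not_exists, not_and, or_assoc, ne_eq]

lemma union_inter_left_of_disjoint (hST : Disjoint S T) {U V : Finset α} (hU : U ⊆ S)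
    (hV : V ⊆ T) : (U ∪ V) ∩ S = U := by
  rw [union_inter_distrib_right, inter_eq_left.2 hU,
    disjoint_iff_inter_eq_empty.1 (hST.symm.mono_left hV), union_empty]

lemma union_inter_right_of_disjoint (hST : Disjoint S T) {U V : Finset α} (hU : U ⊆ S)
    (hV : V ⊆ T) : (U ∪ V) ∩ T = V := by
  rw [union_comm, union_inter_left_of_disjoint hST.symm hV hU]

lemma union_notMem_left (hST : Disjoint S T) (hA : ∀ U ∈ A, U ⊆ S) {U V : Finset α}
    (hVT : V ⊆ T) (hV : V.Nonempty) : U ∪ V ∉ A := fun h =>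
  hV.ne_empty (disjoint_self_iff_empty V |>.1
    (hST.mono (subset_union_right.trans (hA _ h)) hVT))

lemma union_mem_mergePairs_iff (hST : Disjoint S T) (hA : ∀ U ∈ A, U ⊆ S ∧ U.Nonempty)
    (hB : ∀ V ∈ B, V ⊆ T ∧ V.Nonempty) (hM : M ∈ matchings A B) {U V : Finset α}
    (hU : U ∈ A) (hV : V ∈ B) : U ∪ V ∈ mergePairs A B M ↔ (U, V) ∈ M := by
  rw [mem_mergePairs]
  constructor
  · rintro (h | h | ⟨p, hp, h⟩)
    · exact (union_notMem_left hST (fun U hU => (hA U hU).1) (hB V hV).1 (hB V hV).2 h.1).elim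
    · rw [union_comm] at h
      exact (union_notMem_left hST.symm (fun V hV => (hB V hV).1) (hA U hU).1
        (hA U hU).2 h.1).elim
    · have hp' := (mem_matchings.1 hM).1 p hp
      have h1 := congrArg (· ∩ S) h
      have h2 := congrArg (· ∩ T) h
      simp only [union_inter_left_of_disjoint hST (hA _ hp'.1).1 (hB _ hp'.2).1,
        union_inter_left_of_disjoint hST (hA U hU).1 (hB V hV).1] at h1
      simp only [union_inter_right_of_disjoint hST (hA _ hp'.1).1 (hB _ hp'.2).1,
        union_inter_right_of_disjoint hST (hA U hU).1 (hB V hV).1] at h2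
      rwa [← h1, ← h2]
  · exact fun h => Or.inr (Or.inr ⟨_, h, rfl⟩)

lemma card_mergePairs (hST : Disjoint S T) (hA : ∀ U ∈ A, U ⊆ S ∧ U.Nonempty)
    (hB : ∀ V ∈ B, V ⊆ T ∧ V.Nonempty) (hM : M ∈ matchings A B) :
    (mergePairs A B M).card = A.card + B.card - M.card := by
  have hM' := (mem_matchings.1 hM).1
  have hAB : Disjoint (A \ M.image Prod.fst) (B \ M.image Prod.snd) := by
    rw [disjoint_left]
    intro U hU hU'
    have hU := hA U (mem_sdiff.1 hU).1
    have hU' := hB U (mem_sdiff.1 hU').1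
    exact hU.2.ne_empty (disjoint_self_iff_empty U |>.1 (hST.mono hU.1 hU'.1))
  have hmerged : Disjoint (A \ M.image Prod.fst ∪ B \ M.image Prod.snd)
      (M.image fun p => p.1 ∪ p.2) := by
    rw [disjoint_right]
    intro X hX hX'
    obtain ⟨p, hp, rfl⟩ := mem_image.1 hX
    have hpA := hA _ (hM' p hp).1
    have hpB := hB _ (hM' p hp).2
    rcases mem_union.1 hX' with h | h
    · exact union_notMem_left hST (fun U hU => (hA U hU).1) hpB.1 hpB.2 (mem_sdiff.1 h).1
    · rw [union_comm] at h
      exact union_notMem_left hST.symm (fun V hV => (hB V hV).1) hpA.1 hpA.2 (mem_sdiff.1 h).1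
  have hinj : Set.InjOn (fun p : Finset α × Finset α => p.1 ∪ p.2) M := by
    intro p hp q hq h
    have h1 := congrArg (· ∩ S) h
    simp only [union_inter_left_of_disjoint hST (hA _ (hM' p hp).1).1 (hB _ (hM' p hp).2).1,
      union_inter_left_of_disjoint hST (hA _ (hM' q hq).1).1 (hB _ (hM' q hq).2).1] at h1
    exact ((mem_matchings.1 hM).2 p hp q hq).1 h1
  have hfst := card_le_card (image_fst_subset_of_mem_matchings hM)
  have hsnd := card_le_card (image_snd_subset_of_mem_matchings hM)
  rw [mergePairs, card_union_of_disjoint hmerged, card_union_of_disjoint hAB,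
    card_sdiff_of_subset (image_fst_subset_of_mem_matchings hM),
    card_sdiff_of_subset (image_snd_subset_of_mem_matchings hM), card_image_of_injOn hinj]
  rw [card_image_fst_of_mem_matchings hM] at hfst ⊢
  rw [card_image_snd_of_mem_matchings hM] at hsnd ⊢
  omega

end MergePairs

section Trace

variable {k : ℕ} {S T : Finset (Fin k)} {Z P A B : Finset (Finset (Fin k))}
  {M : Finset (Finset (Fin k) × Finset (Fin k))}

lemma mem_interTrace {X : Finset (Fin k)} :
    X ∈ interTrace S T P ↔ X.Nonempty ∧ ∃ Y ∈ P, Y ∩ S = X ∨ Y ∩ T = X := by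
  simp only [interTrace, mem_filter, mem_union, mem_image]
  grind

lemma IsPartitionOfFin.eq_of_mem (hP : IsPartitionOfFin P) {X Y : Finset (Fin k)} (hX : X ∈ P)
    (hY : Y ∈ P) {x : Fin k} (hxX : x ∈ X) (hxY : x ∈ Y) : X = Y :=
  by_contra fun h => disjoint_left.1 (hP.2.1 X hX Y hY h) hxX hxY

lemma IsPartitionOfFin.exists_mem (hP : IsPartitionOfFin P) (x : Fin k) : ∃ X ∈ P, x ∈ X := by
  have := mem_univ x
  rw [← hP.2.2] at this
  simpa [mem_sup] using this

lemma isPartitionOfFin_iff : IsPartitionOfFin P ↔ (∀ X ∈ P, X.Nonempty) ∧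
    (∀ X ∈ P, ∀ Y ∈ P, ∀ x ∈ X, x ∈ Y → X = Y) ∧ ∀ x, ∃ X ∈ P, x ∈ X := by
  refine ⟨fun h => ⟨h.1, fun X hX Y hY x hxX hxY => h.eq_of_mem hX hY hxX hxY, h.exists_mem⟩,
    fun h => ⟨h.1, fun X hX Y hY hne => disjoint_left.2 fun x hxX hxY =>
      hne (h.2.1 X hX Y hY x hxX hxY), ?_⟩⟩
  ext x
  simpa [mem_sup] using h.2.2 x

/-- The pairs of traces on `S` and `T` that are merged in `P`. -/
def mergedPairs (A B P : Finset (Finset (Fin k))) : Finset (Finset (Fin k) × Finset (Fin k)) :=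
  (A ×ˢ B).filter fun p => p.1 ∪ p.2 ∈ P

lemma mem_mergedPairs {p : Finset (Fin k) × Finset (Fin k)} :
    p ∈ mergedPairs A B P ↔ (p.1 ∈ A ∧ p.2 ∈ B) ∧ p.1 ∪ p.2 ∈ P := by
  simp [mergedPairs]

lemma mergedPairs_mem_matchings (hST : Disjoint S T) (hA : ∀ U ∈ A, U ⊆ S ∧ U.Nonempty)
    (hB : ∀ V ∈ B, V ⊆ T ∧ V.Nonempty) (hP : IsPartitionOfFin P) :
    mergedPairs A B P ∈ matchings A B := by
  have key : ∀ p ∈ mergedPairs A B P, ∀ q ∈ mergedPairs A B P, ∀ x ∈ p.1 ∪ p.2,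
      x ∈ q.1 ∪ q.2 → p = q := by
    intro p hp q hq x hxp hxq
    rw [mem_mergedPairs] at hp hq
    have h := hP.eq_of_mem hp.2 hq.2 hxp hxq
    have h1 := congrArg (· ∩ S) h
    have h2 := congrArg (· ∩ T) h
    simp only [union_inter_left_of_disjoint hST (hA _ hp.1.1).1 (hB _ hp.1.2).1,
      union_inter_left_of_disjoint hST (hA _ hq.1.1).1 (hB _ hq.1.2).1] at h1
    simp only [union_inter_right_of_disjoint hST (hA _ hp.1.1).1 (hB _ hp.1.2).1,
      union_inter_right_of_disjoint hST (hA _ hq.1.1).1 (hB _ hq.1.2).1] at h2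
    exact Prod.ext h1 h2
  refine mem_matchings.2 ⟨fun p hp => (mem_mergedPairs.1 hp).1, fun p hp q hq => ⟨fun h => ?_,
    fun h => ?_⟩⟩
  · obtain ⟨x, hx⟩ := (hA _ (mem_mergedPairs.1 hp).1.1).2
    exact key p hp q hq x (mem_union_left _ hx) (mem_union_left _ (h ▸ hx))
  · obtain ⟨x, hx⟩ := (hB _ (mem_mergedPairs.1 hp).1.2).2
    exact key p hp q hq x (mem_union_right _ hx) (mem_union_right _ (h ▸ hx))

lemma mergedPairs_mergePairs (hST : Disjoint S T) (hA : ∀ U ∈ A, U ⊆ S ∧ U.Nonempty)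
    (hB : ∀ V ∈ B, V ⊆ T ∧ V.Nonempty) (hM : M ∈ matchings A B) :
    mergedPairs A B (mergePairs A B M) = M := by
  ext p
  rw [mem_mergedPairs]
  refine ⟨fun h => (union_mem_mergePairs_iff hST hA hB hM h.1.1 h.1.2).1 h.2, fun h => ?_⟩
  have hpAB := (mem_matchings.1 hM).1 p h
  exact ⟨hpAB, (union_mem_mergePairs_iff hST hA hB hM hpAB.1 hpAB.2).2 h⟩

/-- An unmerged trace of a partition is itself a block. -/
lemma inter_mem_of_forall_union_notMem (hSTuniv : S ∪ T = univ) {Y : Finset (Fin k)}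
    (hY : Y ∈ P) (hB : ∀ Y ∈ P, (Y ∩ T).Nonempty → Y ∩ T ∈ B)
    (h : ∀ V ∈ B, Y ∩ S ∪ V ∉ P) : Y ∩ S ∈ P := by
  have hYST : Y ∩ S ∪ Y ∩ T = Y := by rw [← inter_union_distrib_left, hSTuniv, inter_univ]
  rcases (Y ∩ T).eq_empty_or_nonempty with h0 | h0
  · rw [h0, union_empty] at hYST
    rwa [hYST]
  · exact (h _ (hB Y hY h0) (hYST.symm ▸ hY)).elim

lemma mergePairs_mergedPairs (hST : Disjoint S T) (hSTuniv : S ∪ T = univ)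
    (hP : IsPartitionOfFin P) (hA : ∀ U, U ∈ A ↔ U.Nonempty ∧ ∃ Y ∈ P, Y ∩ S = U)
    (hB : ∀ V, V ∈ B ↔ V.Nonempty ∧ ∃ Y ∈ P, Y ∩ T = V) :
    mergePairs A B (mergedPairs A B P) = P := by
  have hA' : ∀ Y ∈ P, (Y ∩ S).Nonempty → Y ∩ S ∈ A := fun Y hY h => (hA _).2 ⟨h, Y, hY, rfl⟩
  have hB' : ∀ Y ∈ P, (Y ∩ T).Nonempty → Y ∩ T ∈ B := fun Y hY h => (hB _).2 ⟨h, Y, hY, rfl⟩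
  have hAS : ∀ U ∈ A, U ⊆ S := fun U hU => by
    obtain ⟨-, Y, -, rfl⟩ := (hA U).1 hU
    exact inter_subset_right
  have hBT : ∀ V ∈ B, V ⊆ T := fun V hV => by
    obtain ⟨-, Y, -, rfl⟩ := (hB V).1 hV
    exact inter_subset_right
  ext X
  rw [mem_mergePairs]
  constructor
  · rintro (⟨hX, h⟩ | ⟨hX, h⟩ | ⟨p, hp, rfl⟩)
    · obtain ⟨-, Y, hY, rfl⟩ := (hA X).1 hX
      exact inter_mem_of_forall_union_notMem hSTuniv hY hB' fun V hV hVP =>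
        h (_, V) (mem_mergedPairs.2 ⟨⟨hX, hV⟩, hVP⟩) rfl
    · obtain ⟨-, Y, hY, rfl⟩ := (hB X).1 hX
      refine inter_mem_of_forall_union_notMem (union_comm S T ▸ hSTuniv) hY hA'
        fun U hU hUP => h (U, _) (mem_mergedPairs.2 ⟨⟨hU, hX⟩, ?_⟩) rfl
      rwa [union_comm]
    · exact (mem_mergedPairs.1 hp).2
  · intro hX
    have hXST : X ∩ S ∪ X ∩ T = X := by rw [← inter_union_distrib_left, hSTuniv, inter_univ]
    obtain ⟨x, hx⟩ := hP.1 X hX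
    rcases (X ∩ T).eq_empty_or_nonempty with hT0 | hT0
    · rw [hT0, union_empty] at hXST
      left
      refine ⟨hXST ▸ hA' X hX (hXST.symm ▸ ⟨x, hx⟩), ?_⟩
      rintro p hp rfl
      rw [mem_mergedPairs] at hp
      have h := hP.eq_of_mem hp.2 hX (mem_union_left _ hx) hx
      exact union_notMem_left hST hAS (hBT _ hp.1.2) ((hB _).1 hp.1.2).1 (h.symm ▸ hp.1.1)
    · rcases (X ∩ S).eq_empty_or_nonempty with hS0 | hS0
      · rw [hS0, empty_union] at hXST
        right; left
        refine ⟨hXST ▸ hB' X hX (hXST.symm ▸ ⟨x, hx⟩), ?_⟩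
        rintro p hp rfl
        rw [mem_mergedPairs] at hp
        have h := hP.eq_of_mem hp.2 hX (mem_union_right _ hx) hx
        rw [union_comm] at h
        exact union_notMem_left hST.symm hBT (hAS _ hp.1.1) ((hA _).1 hp.1.1).1
          (h.symm ▸ hp.1.2)
      · right; right
        exact ⟨(X ∩ S, X ∩ T), mem_mergedPairs.2 ⟨⟨hA' X hX hS0, hB' X hX hT0⟩,
          hXST.symm ▸ hX⟩, hXST⟩

/-- Every block of `A ∪ B` lies in a block of `mergePairs A B M`. -/
lemma exists_mem_mergePairs_superset {U : Finset (Fin k)}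
    (hU : U ∈ A ∨ U ∈ B) : ∃ X ∈ mergePairs A B M, U ⊆ X := by
  by_cases h : ∃ p ∈ M, p.1 = U ∨ p.2 = U
  · obtain ⟨p, hp, rfl | rfl⟩ := h
    · exact ⟨_, mem_mergePairs.2 (Or.inr (Or.inr ⟨p, hp, rfl⟩)), subset_union_left⟩
    · exact ⟨_, mem_mergePairs.2 (Or.inr (Or.inr ⟨p, hp, rfl⟩)), subset_union_right⟩
  · push Not at h
    refine ⟨U, mem_mergePairs.2 ?_, Subset.rfl⟩
    rcases hU with hU | hU
    · exact Or.inl ⟨hU, fun p hp => (h p hp).1⟩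
    · exact Or.inr (Or.inl ⟨hU, fun p hp => (h p hp).2⟩)

lemma isPartitionOfFin_mergePairs (hST : Disjoint S T) (hZpart : IsPartitionOfFin Z)
    (hZ : ∀ {U}, U ∈ Z ↔ U ∈ A ∨ U ∈ B) (hA : ∀ U ∈ A, U ⊆ S ∧ U.Nonempty)
    (hB : ∀ V ∈ B, V ⊆ T ∧ V.Nonempty) (hM : M ∈ matchings A B) :
    IsPartitionOfFin (mergePairs A B M) := by
  have hM' := mem_matchings.1 hM
  refine isPartitionOfFin_iff.2 ⟨fun X hX => ?_, fun X hX Y hY x hxX hxY => ?_, fun x => ?_⟩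
  · rcases mem_mergePairs.1 hX with h | h | ⟨p, hp, rfl⟩
    · exact (hA X h.1).2
    · exact (hB X h.1).2
    · exact (hA _ (hM'.1 p hp).1).2.mono subset_union_left
  · have hAA : ∀ U ∈ A, ∀ V ∈ A, x ∈ U → x ∈ V → U = V := fun U hU V hV =>
      hZpart.eq_of_mem (hZ.2 (Or.inl hU)) (hZ.2 (Or.inl hV))
    have hBB : ∀ U ∈ B, ∀ V ∈ B, x ∈ U → x ∈ V → U = V := fun U hU V hV =>
      hZpart.eq_of_mem (hZ.2 (Or.inr hU)) (hZ.2 (Or.inr hV))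
    have hAB : ∀ U ∈ A, ∀ V ∈ B, x ∈ U → x ∉ V := fun U hU V hV hxU hxV =>
      disjoint_left.1 hST ((hA U hU).1 hxU) ((hB V hV).1 hxV)
    rw [mem_mergePairs] at hX hY
    grind
  · obtain ⟨U, hU, hxU⟩ := hZpart.exists_mem x
    obtain ⟨X, hX, hUX⟩ := exists_mem_mergePairs_superset (M := M) (hZ.1 hU)
    exact ⟨X, hX, hUX hxU⟩

lemma interTrace_mergePairs (hST : Disjoint S T) (hZ : ∀ {U}, U ∈ Z ↔ U ∈ A ∨ U ∈ B)
    (hA : ∀ U ∈ A, U ⊆ S ∧ U.Nonempty) (hB : ∀ V ∈ B, V ⊆ T ∧ V.Nonempty)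
    (hM : M ∈ matchings A B) : interTrace S T (mergePairs A B M) = Z := by
  have hM' := (mem_matchings.1 hM).1
  have hAS : ∀ U ∈ A, U ∩ S = U ∧ U ∩ T = ∅ := fun U hU =>
    ⟨inter_eq_left.2 (hA U hU).1, disjoint_iff_inter_eq_empty.1 (hST.mono_left (hA U hU).1)⟩
  have hBT : ∀ V ∈ B, V ∩ S = ∅ ∧ V ∩ T = V := fun V hV =>
    ⟨disjoint_iff_inter_eq_empty.1 (hST.symm.mono_left (hB V hV).1),
      inter_eq_left.2 (hB V hV).1⟩
  have hpair : ∀ p ∈ M, (p.1 ∪ p.2) ∩ S = p.1 ∧ (p.1 ∪ p.2) ∩ T = p.2 := fun p hp =>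
    ⟨union_inter_left_of_disjoint hST (hA _ (hM' p hp).1).1 (hB _ (hM' p hp).2).1,
      union_inter_right_of_disjoint hST (hA _ (hM' p hp).1).1 (hB _ (hM' p hp).2).1⟩
  ext U
  rw [mem_interTrace, hZ]
  constructor
  · rintro ⟨hU, X, hX, h⟩
    have := hU.ne_empty
    rcases mem_mergePairs.1 hX with ⟨hX, -⟩ | ⟨hX, -⟩ | ⟨p, hp, rfl⟩
    · rw [(hAS X hX).1, (hAS X hX).2] at h
      rcases h with rfl | rfl
      · exact Or.inl hX
      · exact (this rfl).elim
    · rw [(hBT X hX).1, (hBT X hX).2] at h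
      rcases h with rfl | rfl
      · exact (this rfl).elim
      · exact Or.inr hX
    · rw [(hpair p hp).1, (hpair p hp).2] at h
      rcases h with rfl | rfl
      · exact Or.inl (hM' p hp).1
      · exact Or.inr (hM' p hp).2
  · intro hU
    refine ⟨hU.elim (fun h => (hA U h).2) fun h => (hB U h).2, ?_⟩
    by_cases h : ∃ p ∈ M, p.1 = U ∨ p.2 = U
    · obtain ⟨p, hp, h⟩ := h
      refine ⟨_, mem_mergePairs.2 (Or.inr (Or.inr ⟨p, hp, rfl⟩)), ?_⟩
      rwa [(hpair p hp).1, (hpair p hp).2]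
    · push Not at h
      rcases hU with hU | hU
      · exact ⟨U, mem_mergePairs.2 (Or.inl ⟨hU, fun p hp => (h p hp).1⟩), Or.inl (hAS U hU).1⟩
      · exact ⟨U, mem_mergePairs.2 (Or.inr (Or.inl ⟨hU, fun p hp => (h p hp).2⟩)),
          Or.inr (hBT U hU).2⟩

end Trace

/-- Let `k ≥ 2`, let `(S,T)` be a partition of `{1,…,k}` into two nonempty sets, and let
`Z` be an unordered partition of `{1,…,k}` into nonempty blocks, each block contained in `S`
or in `T`.  Then `Σ_L (−1)^{|L|} (|L|−1)! = 0`, the sum ranging over all unordered partitions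
`L` of `{1,…,k}` into nonempty blocks such that the collection of all nonempty sets among
`{L_i ∩ S, L_i ∩ T : i}` equals exactly `Z`. -/
theorem stmt1 (k : ℕ) (hk : 2 ≤ k) (S T : Finset (Fin k))
    (hS : S.Nonempty) (hT : T.Nonempty) (hST : Disjoint S T) (hSTuniv : S ∪ T = Finset.univ)
    (Z : Finset (Finset (Fin k))) (hZpart : IsPartitionOfFin Z)
    (hZ : ∀ B ∈ Z, B ⊆ S ∨ B ⊆ T) :
    ∑ P ∈ Finset.univ.filter
        (fun P : Finset (Finset (Fin k)) => IsPartitionOfFin P ∧ interTrace S T P = Z),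
      ((-1 : ℝ) ^ P.card * (Nat.factorial (P.card - 1) : ℝ)) = 0 := by
  set A := Z.filter (· ⊆ S) with hAdef
  set B := Z.filter (· ⊆ T) with hBdef
  have hA : ∀ U ∈ A, U ⊆ S ∧ U.Nonempty := fun U hU =>
    ⟨(mem_filter.1 hU).2, hZpart.1 U (mem_filter.1 hU).1⟩
  have hB : ∀ V ∈ B, V ⊆ T ∧ V.Nonempty := fun V hV =>
    ⟨(mem_filter.1 hV).2, hZpart.1 V (mem_filter.1 hV).1⟩
  have hZAB : ∀ {U}, U ∈ Z ↔ U ∈ A ∨ U ∈ B := by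
    intro U
    simp only [hAdef, hBdef, mem_filter]
    have := hZ U
    tauto
  have hAne : A.Nonempty := by
    obtain ⟨x, hx⟩ := hS
    obtain ⟨U, hU, hxU⟩ := hZpart.exists_mem x
    exact ⟨U, mem_filter.2 ⟨hU, (hZ U hU).resolve_right fun h =>
      disjoint_left.1 hST hx (h hxU)⟩⟩
  have hBne : B.Nonempty := by
    obtain ⟨x, hx⟩ := hT
    obtain ⟨U, hU, hxU⟩ := hZpart.exists_mem x
    exact ⟨U, mem_filter.2 ⟨hU, (hZ U hU).resolve_left fun h =>
      disjoint_left.1 hST (h hxU) hx⟩⟩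
  rw [← sum_matchings_neg_one_pow_mul_factorial hAne hBne]
  symm
  refine sum_nbij' (mergePairs A B) (mergedPairs A B) ?_ ?_ ?_ ?_ ?_
  · intro M hM
    rw [mem_filter]
    exact ⟨mem_univ _, isPartitionOfFin_mergePairs hST hZpart hZAB hA hB hM,
      interTrace_mergePairs hST hZAB hA hB hM⟩
  · intro P hP
    exact mergedPairs_mem_matchings hST hA hB (mem_filter.1 hP).2.1
  · intro M hM
    exact mergedPairs_mergePairs hST hA hB hM
  · intro P hP
    obtain ⟨-, hPpart, rfl⟩ := mem_filter.1 hP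
    have hne : ∀ {U : Finset (Fin k)}, U.Nonempty → U ⊆ S → ¬ U ⊆ T := fun hU h h' =>
      hU.ne_empty ((disjoint_self_iff_empty _).1 (hST.mono h h'))
    refine mergePairs_mergedPairs hST hSTuniv hPpart (fun U => ?_) (fun V => ?_)
    · rw [hAdef, mem_filter, mem_interTrace]
      constructor
      · rintro ⟨⟨hU, Y, hY, h | h⟩, hUS⟩
        · exact ⟨hU, Y, hY, h⟩
        · exact (hne hU hUS (h ▸ inter_subset_right)).elim
      · rintro ⟨hU, Y, hY, h⟩
        exact ⟨⟨hU, Y, hY, Or.inl h⟩, h ▸ inter_subset_right⟩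
    · rw [hBdef, mem_filter, mem_interTrace]
      constructor
      · rintro ⟨⟨hV, Y, hY, h | h⟩, hVT⟩
        · exact (hne hV (h ▸ inter_subset_right) hVT).elim
        · exact ⟨hV, Y, hY, h⟩
      · rintro ⟨hV, Y, hY, h⟩
        exact ⟨⟨hV, Y, hY, Or.inr h⟩, h ▸ inter_subset_right⟩
  · intro M hM
    rw [card_mergePairs hST hA hB hM]
end

section
/- Let Y be a real random variable with finite absolute moments of all orders and E[Y] = 0, and suppose there exist γ ≥ 0, H > 0 and Δ > 0 such that |c^k[Y]| ≤ (k!/2)^{1+γ} H/Δ^{k−2} for all k = 2,3,…. Then for all y ≥ 0, P(Y ≥ y) ≤ exp(−(1/4) min{ y²/H, (Δy)^{1/(1+γ)} }). -/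
open Finset MeasureTheory ProbabilityTheory Real

/-- The `k`-th cumulant of a real random variable `Y`:
`c^k[Y] = Σ_π (−1)^{|π|−1} (|π|−1)! Π_{B∈π} E[Y^{|B|}]`, the sum ranging over all
unordered partitions `π` of `{1,…,k}` into nonempty blocks. -/
noncomputable def cumulantRV {Ω : Type*} [MeasurableSpace Ω] (μ : Measure Ω)
    (Y : Ω → ℝ) (k : ℕ) : ℝ :=
  ∑ P ∈ Finset.univ.filter (IsPartitionOfFin (k := k)),
    (-1 : ℝ) ^ (P.card - 1) * (Nat.factorial (P.card - 1) : ℝ) *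
      ∏ B ∈ P, ∫ ω, (Y ω) ^ B.card ∂μ


section Combinatorics

variable {α : Type*} [DecidableEq α]

/-- The partitions of the finite set `S` into exactly `r` nonempty blocks. -/
def partitionsWithCard (S : Finset α) (r : ℕ) : Finset (Finset (Finset α)) :=
  {P ∈ S.powerset.powerset | (∀ B ∈ P, B.Nonempty) ∧
    (∀ B ∈ P, ∀ B' ∈ P, B ≠ B' → Disjoint B B') ∧ P.sup id = S ∧ P.card = r}

theorem mem_partitionsWithCard {S : Finset α} {r : ℕ} {P : Finset (Finset α)} :
    P ∈ partitionsWithCard S r ↔ (∀ B ∈ P, B.Nonempty) ∧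
      (∀ B ∈ P, ∀ B' ∈ P, B ≠ B' → Disjoint B B') ∧ P.sup id = S ∧ P.card = r := by
  simp only [partitionsWithCard, mem_filter, mem_powerset, and_iff_right_iff_imp]
  rintro ⟨-, -, rfl, -⟩ B hB
  exact mem_powerset.2 (Finset.le_sup (f := id) hB)

theorem partitionsWithCard_zero_of_nonempty {S : Finset α} (hS : S.Nonempty) :
    partitionsWithCard S 0 = ∅ := by
  ext P
  simp only [mem_partitionsWithCard, card_eq_zero, notMem_empty, iff_false]
  rintro ⟨-, -, h, rfl⟩
  simp only [sup_empty, bot_eq_empty] at h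
  exact hS.ne_empty h.symm

theorem partitionsWithCard_empty_zero : partitionsWithCard (∅ : Finset α) 0 = {∅} := by
  ext P
  simp only [mem_partitionsWithCard, card_eq_zero, mem_singleton]
  constructor
  · exact fun h => h.2.2.2
  · rintro rfl; simp

theorem partitionsWithCard_empty_succ (r : ℕ) :
    partitionsWithCard (∅ : Finset α) (r + 1) = ∅ := by
  ext P
  simp only [mem_partitionsWithCard, notMem_empty, iff_false]
  rintro ⟨h1, -, h3, h4⟩
  obtain ⟨B, hB⟩ := card_pos.1 (by omega : 0 < P.card)
  have h : B ⊆ P.sup id := Finset.le_sup (f := id) hB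
  rw [h3, subset_empty] at h
  exact (h1 B hB).ne_empty h

/-- Splitting off the block that contains a given element. -/
theorem sum_partitionsWithCard_insert {a : α} {S : Finset α} (ha : a ∉ S) (r : ℕ)
    (f : Finset α → ℝ) :
    ∑ P ∈ partitionsWithCard (insert a S) (r + 1), ∏ B ∈ P, f B =
      ∑ T ∈ S.powerset, f (insert a T) * ∑ Q ∈ partitionsWithCard (S \ T) r, ∏ B ∈ Q, f B := by
  have key : ∀ T ∈ S.powerset, ∀ Q ∈ partitionsWithCard (S \ T) r,
      ∀ B ∈ Q, a ∉ B ∧ Disjoint B T ∧ B ⊆ S := by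
    intro T hT Q hQ B hB
    have hBQ : B ⊆ S \ T := (mem_partitionsWithCard.1 hQ).2.2.1 ▸ Finset.le_sup (f := id) hB
    exact ⟨fun h => ha (sdiff_subset (hBQ h)), disjoint_of_subset_left hBQ sdiff_disjoint,
      hBQ.trans sdiff_subset⟩
  have hnot : ∀ T ∈ S.powerset, ∀ Q ∈ partitionsWithCard (S \ T) r, insert a T ∉ Q :=
    fun T hT Q hQ h => (key T hT Q hQ _ h).1 (mem_insert_self a T)
  simp only [mul_sum]
  rw [sum_sigma', eq_comm]
  refine sum_bij (fun x _ => insert (insert a x.1) x.2) ?_ ?_ ?_ ?_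
  · rintro ⟨T, Q⟩ hx
    obtain ⟨hT, hQ⟩ := mem_sigma.1 hx
    have hk := key T hT Q hQ
    have hn := hnot T hT Q hQ
    obtain ⟨h1, h2, h3, h4⟩ := mem_partitionsWithCard.1 hQ
    have hd : ∀ B ∈ Q, Disjoint (insert a T) B := fun B hB =>
      disjoint_insert_left.2 ⟨(hk B hB).1, (hk B hB).2.1.symm⟩
    refine mem_partitionsWithCard.2 ⟨?_, ?_, ?_, ?_⟩
    · intro B hB
      rcases mem_insert.1 hB with rfl | hB
      · exact insert_nonempty _ _
      · exact h1 B hB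
    · intro B hB B' hB' hne
      rcases mem_insert.1 hB with rfl | hB <;> rcases mem_insert.1 hB' with rfl | hB'
      · exact absurd rfl hne
      · exact hd B' hB'
      · exact (hd B hB).symm
      · exact h2 B hB B' hB' hne
    · rw [sup_insert, h3, id, sup_eq_union, insert_union,
        union_sdiff_of_subset (mem_powerset.1 hT)]
    · rw [card_insert_of_notMem hn, h4]
  · rintro ⟨T, Q⟩ hx ⟨T', Q'⟩ hx' heq
    obtain ⟨hT, hQ⟩ := mem_sigma.1 hx
    obtain ⟨hT', hQ'⟩ := mem_sigma.1 hx'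
    dsimp only at hT hQ hT' hQ' heq
    have hTT : insert a T = insert a T' := by
      have h : insert a T ∈ insert (insert a T') Q' := heq ▸ mem_insert_self _ _
      rcases mem_insert.1 h with h | h
      · exact h
      · exact absurd (mem_insert_self a T) (key T' hT' Q' hQ' _ h).1
    have haT : a ∉ T := fun h => ha (mem_powerset.1 hT h)
    have haT' : a ∉ T' := fun h => ha (mem_powerset.1 hT' h)
    obtain rfl : T = T' := by
      rw [← erase_insert haT, hTT, erase_insert haT']
    obtain rfl : Q = Q' := by
      rw [← erase_insert (hnot T hT Q hQ), heq, erase_insert (hnot T hT' Q' hQ')]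
    rfl
  · intro P hP
    obtain ⟨h1, h2, h3, h4⟩ := mem_partitionsWithCard.1 hP
    have haP : a ∈ P.sup id := h3 ▸ mem_insert_self a S
    obtain ⟨B, hB, haB⟩ := mem_sup.1 haP
    have haB : a ∈ B := haB
    have hBS : B ⊆ insert a S := h3 ▸ Finset.le_sup (f := id) hB
    refine ⟨⟨B.erase a, P.erase B⟩, ?_, ?_⟩
    · refine mem_sigma.2 ⟨mem_powerset.2 ?_, mem_partitionsWithCard.2 ⟨?_, ?_, ?_, ?_⟩⟩
      · exact subset_insert_iff.1 hBS
      · exact fun B' hB' => h1 B' (mem_of_mem_erase hB')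
      · exact fun B₁ hB₁ B₂ hB₂ =>
          h2 B₁ (mem_of_mem_erase hB₁) B₂ (mem_of_mem_erase hB₂)
      · have hd : Disjoint B ((P.erase B).sup id) := by
          rw [Finset.disjoint_sup_right]
          exact fun B' hB' => h2 B hB B' (mem_of_mem_erase hB') (ne_of_mem_erase hB').symm
        have hu : B ∪ (P.erase B).sup id = insert a S := by
          rw [← h3]
          conv_rhs => rw [← insert_erase hB, sup_insert]
          rfl
        ext x
        have hx : x ∈ B ∪ (P.erase B).sup id ↔ x ∈ insert a S := by rw [hu]
        have hdx : x ∈ B → x ∉ (P.erase B).sup id := fun h => Finset.disjoint_left.1 hd h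
        simp only [mem_union, mem_insert] at hx
        simp only [mem_sdiff, mem_erase]
        grind
      · rw [card_erase_of_mem hB, h4]; rfl
    · simp only [insert_erase haB, insert_erase hB]
  · rintro ⟨T, Q⟩ hx
    obtain ⟨hT, hQ⟩ := mem_sigma.1 hx
    exact (prod_insert (hnot T hT Q hQ)).symm

end Combinatorics

section GeneratingFunctions

open PowerSeries

/-- The exponential generating function of `m`, with its constant term removed. -/
noncomputable def egfSubConst (m : ℕ → ℝ) : PowerSeries ℝ :=
  PowerSeries.mk fun k => if k = 0 then 0 else m k / (k.factorial : ℝ)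

theorem coeff_derivative_egfSubConst (m : ℕ → ℝ) (k : ℕ) :
    coeff k (d⁄dX ℝ (egfSubConst m)) = m (k + 1) / (k.factorial : ℝ) := by
  rw [coeff_derivative, egfSubConst, coeff_mk, if_neg k.succ_ne_zero, Nat.factorial_succ]
  have : (k.factorial : ℝ) ≠ 0 := by positivity
  push_cast
  field_simp

theorem X_dvd_egfSubConst (m : ℕ → ℝ) : X ∣ egfSubConst m := by
  rw [X_dvd_iff, ← coeff_zero_eq_constantCoeff_apply]
  simp [egfSubConst]

/-- The exponential formula for partitions with a fixed number of blocks. -/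
theorem sum_partitionsWithCard_prod {α : Type*} [DecidableEq α] (m : ℕ → ℝ) (S : Finset α)
    (r : ℕ) :
    ∑ P ∈ partitionsWithCard S r, ∏ B ∈ P, m B.card =
      (S.card.factorial : ℝ) * coeff S.card (egfSubConst m ^ r) / (r.factorial : ℝ) := by
  induction hn : S.card using Nat.strong_induction_on generalizing S r with
  | _ n ih =>
  subst hn
  rcases S.eq_empty_or_nonempty with rfl | ⟨a, haS⟩
  · cases r with
    | zero => simp [partitionsWithCard_empty_zero]
    | succ r =>
      rw [partitionsWithCard_empty_succ]
      simp [egfSubConst, constantCoeff_mk]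
  · obtain ⟨S, ha, rfl⟩ : ∃ S', a ∉ S' ∧ S = insert a S' :=
      ⟨S.erase a, notMem_erase a S, (insert_erase haS).symm⟩
    rw [card_insert_of_notMem ha] at ih ⊢
    cases r with
    | zero =>
      rw [partitionsWithCard_zero_of_nonempty (insert_nonempty a S)]
      simp [coeff_one]
    | succ r =>
      rw [sum_partitionsWithCard_insert ha r (fun B => m B.card)]
      have hterm : ∀ T ∈ S.powerset, m (insert a T).card *
          ∑ Q ∈ partitionsWithCard (S \ T) r, ∏ B ∈ Q, m B.card =
          (fun j => m (j + 1) * (((S.card - j).factorial : ℝ) *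
            coeff (S.card - j) (egfSubConst m ^ r) / (r.factorial : ℝ))) T.card := by
        intro T hT
        have hTS := mem_powerset.1 hT
        rw [card_insert_of_notMem fun h => ha (hTS h),
          ih _ (Nat.lt_succ_of_le (card_le_card sdiff_subset)) (S \ T) r rfl,
          card_sdiff_of_subset hTS]
      rw [sum_congr rfl hterm, sum_powerset_apply_card (fun j => m (j + 1) *
        (((S.card - j).factorial : ℝ) * coeff (S.card - j) (egfSubConst m ^ r) / (r.factorial : ℝ)))]
      have hcoeff : coeff S.card (d⁄dX ℝ (egfSubConst m ^ (r + 1))) =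
          (r + 1) * ∑ j ∈ range (S.card + 1),
            m (j + 1) / (j.factorial : ℝ) * coeff (S.card - j) (egfSubConst m ^ r) := by
        rw [PowerSeries.derivative_pow, Nat.add_sub_cancel, mul_assoc, mul_comm (_ ^ r),
          ← Nat.cast_succ, ← map_natCast (C (R := ℝ)), coeff_C_mul, coeff_mul,
          Finset.Nat.sum_antidiagonal_eq_sum_range_succ_mk]
        simp only [coeff_derivative_egfSubConst]
      rw [coeff_derivative] at hcoeff
      have hr : ((r + 1).factorial : ℝ) = (r + 1) * (r.factorial : ℝ) := by
        rw [Nat.factorial_succ]; push_cast; ring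
      have hS : ((S.card + 1).factorial : ℝ) = (S.card + 1) * (S.card.factorial : ℝ) := by
        rw [Nat.factorial_succ]; push_cast; ring
      have h0 : (r.factorial : ℝ) ≠ 0 := by positivity
      have h1 : (r + 1 : ℝ) ≠ 0 := by positivity
      rw [hr, hS, show ((S.card + 1 : ℝ) * (S.card.factorial : ℝ)) *
          coeff (S.card + 1) (egfSubConst m ^ (r + 1)) / ((r + 1) * (r.factorial : ℝ)) =
          (S.card.factorial : ℝ) * (coeff (S.card + 1) (egfSubConst m ^ (r + 1)) *
            (S.card + 1)) / ((r + 1) * (r.factorial : ℝ)) by ring, hcoeff]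
      rw [show ∀ s : ℝ, (S.card.factorial : ℝ) * ((r + 1) * s) / ((r + 1) * (r.factorial : ℝ)) =
          (S.card.factorial : ℝ) / (r.factorial : ℝ) * s by intro s; field_simp, mul_sum]
      refine sum_congr rfl fun j hj => ?_
      have hj : j ≤ S.card := Nat.lt_succ_iff.1 (mem_range.1 hj)
      rw [nsmul_eq_mul, Nat.cast_choose ℝ hj]
      have h2 : (j.factorial : ℝ) ≠ 0 := by positivity
      have h3 : ((S.card - j).factorial : ℝ) ≠ 0 := by positivity
      field_simp

/-- The sum over partitions which defines cumulants in terms of moments. -/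
noncomputable def cumulantOfMoments (m : ℕ → ℝ) (k : ℕ) : ℝ :=
  ∑ P ∈ Finset.univ.filter (IsPartitionOfFin (k := k)),
    (-1 : ℝ) ^ (P.card - 1) * (Nat.factorial (P.card - 1) : ℝ) * ∏ B ∈ P, m B.card

/-- The logarithm of the moment generating function, truncated after `R` terms. -/
noncomputable def truncLogEgf (m : ℕ → ℝ) (R : ℕ) : PowerSeries ℝ :=
  ∑ r ∈ range R, C ((-1 : ℝ) ^ r / (r + 1)) * egfSubConst m ^ (r + 1)

theorem cumulantOfMoments_eq_coeff (m : ℕ → ℝ) {k R : ℕ} (hR : 2 ^ (k + 1) ≤ R) :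
    cumulantOfMoments m (k + 1) =
      ((k + 1).factorial : ℝ) * coeff (k + 1) (truncLogEgf m R) := by
  have hmaps : ∀ P ∈ Finset.univ.filter (IsPartitionOfFin (k := k + 1)),
      P.card - 1 ∈ range R := by
    intro P _
    have hle : P.card ≤ 2 ^ (k + 1) := by
      simpa using card_le_univ P
    have hpos : 0 < 2 ^ (k + 1) := by positivity
    exact mem_range.2 (by omega)
  rw [cumulantOfMoments, ← sum_fiberwise_of_maps_to hmaps, truncLogEgf, map_sum, mul_sum]
  refine sum_congr rfl fun r _ => ?_
  have hset : (Finset.univ.filter (IsPartitionOfFin (k := k + 1))).filter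
      (fun P => P.card - 1 = r) = partitionsWithCard (Finset.univ : Finset (Fin (k + 1))) (r + 1) := by
    ext P
    simp only [mem_filter, mem_univ, true_and, mem_partitionsWithCard, IsPartitionOfFin]
    constructor
    · rintro ⟨⟨h1, h2, h3⟩, h4⟩
      refine ⟨h1, h2, h3, ?_⟩
      have : P.card ≠ 0 := by
        rw [Ne, card_eq_zero]
        rintro rfl
        exact (univ_nonempty (α := Fin (k + 1))).ne_empty h3.symm
      omega
    · rintro ⟨h1, h2, h3, h4⟩
      exact ⟨⟨h1, h2, h3⟩, by omega⟩
  rw [hset, sum_congr rfl (g := fun P => (-1 : ℝ) ^ r * (r.factorial : ℝ) * ∏ B ∈ P, m B.card),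
    ← mul_sum, sum_partitionsWithCard_prod, coeff_C_mul, card_univ, Fintype.card_fin,
    Nat.factorial_succ r]
  · have h0 : (r.factorial : ℝ) ≠ 0 := by positivity
    have h1 : (r + 1 : ℝ) ≠ 0 := by positivity
    push_cast
    field_simp
  · intro P hP
    rw [(mem_partitionsWithCard.1 hP).2.2.2, Nat.add_sub_cancel]

/-- The moment-cumulant recursion. -/
theorem moment_cumulant_recursion (m : ℕ → ℝ) (hm : m 0 = 1) (k : ℕ) :
    m (k + 1) / (k.factorial : ℝ) = ∑ p ∈ antidiagonal k,
      cumulantOfMoments m (p.1 + 1) / (p.1.factorial : ℝ) * (m p.2 / (p.2.factorial : ℝ)) := by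
  obtain ⟨R, hR⟩ : ∃ R, R = 2 ^ (k + 1) := ⟨_, rfl⟩
  have hkR : k < R := hR ▸ k.lt_succ_self.trans Nat.lt_two_pow_self
  have hderiv : d⁄dX ℝ (truncLogEgf m R) * (1 + egfSubConst m) =
      d⁄dX ℝ (egfSubConst m) - d⁄dX ℝ (egfSubConst m) * (-egfSubConst m) ^ R := by
    have h : d⁄dX ℝ (truncLogEgf m R) =
        d⁄dX ℝ (egfSubConst m) * ∑ r ∈ range R, (-egfSubConst m) ^ r := by
      rw [truncLogEgf, map_sum, mul_sum]
      refine sum_congr rfl fun r _ => ?_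
      have h1 : (r + 1 : ℝ) ≠ 0 := by positivity
      rw [Derivation.leibniz, PowerSeries.derivative_C, smul_zero, add_zero,
        PowerSeries.derivative_pow, Nat.add_sub_cancel, smul_eq_mul, ← mul_assoc, ← mul_assoc,
        ← map_natCast (C (R := ℝ)), ← map_mul, neg_pow (egfSubConst m), mul_comm (d⁄dX ℝ _)]
      have h2 : (-1 : ℝ) ^ r / (r + 1) * ((r + 1 : ℕ) : ℝ) = (-1) ^ r := by
        push_cast; field_simp
      rw [h2, map_pow, map_neg, map_one]
    have hg := mul_neg_geom_sum (-egfSubConst m) R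
    rw [h, mul_assoc, mul_comm (∑ r ∈ range R, (-egfSubConst m) ^ r), ← sub_neg_eq_add, hg]
    ring
  have hone : ∀ j, coeff j (1 + egfSubConst m) = m j / (j.factorial : ℝ) := by
    intro j
    rcases j with _ | j <;> simp [egfSubConst, coeff_one, hm]
  have hzero : coeff k (d⁄dX ℝ (egfSubConst m) * (-egfSubConst m) ^ R) = 0 := by
    have hdvd : (X : PowerSeries ℝ) ^ R ∣ d⁄dX ℝ (egfSubConst m) * (-egfSubConst m) ^ R :=
      (pow_dvd_pow_of_dvd (dvd_neg.2 (X_dvd_egfSubConst m)) R).mul_left _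
    exact X_pow_dvd_iff.1 hdvd k hkR
  have := congrArg (coeff k) hderiv
  rw [map_sub, hzero, sub_zero, coeff_derivative_egfSubConst, coeff_mul] at this
  rw [← this]
  refine sum_congr rfl fun p hp => ?_
  have hp : p.1 ≤ k := by
    have := mem_antidiagonal.1 hp
    omega
  rw [hone, coeff_derivative,
    cumulantOfMoments_eq_coeff m (hR ▸ Nat.pow_le_pow_right two_pos (by omega) : 2 ^ (p.1 + 1) ≤ R),
    Nat.factorial_succ]
  have h0 : (p.1.factorial : ℝ) ≠ 0 := by positivity
  push_cast
  field_simp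

end GeneratingFunctions

section Exponential

/-- A finite Grönwall inequality for coefficients: if `a` satisfies the recursion of the
coefficients of `exp (∑ b k * t ^ k)` as an inequality, then its partial sums are bounded by
the exponential of the partial sums of `b`. -/
theorem sum_range_le_exp_of_recursion {a b : ℕ → ℝ} (n : ℕ) (ha : ∀ k, 0 ≤ a k)
    (hb : ∀ k, 0 ≤ b k) (ha0 : a 0 ≤ 1)
    (hrec : ∀ k < n, (k + 1 : ℝ) * a (k + 1) ≤
      ∑ p ∈ antidiagonal k, (p.1 + 1 : ℝ) * b (p.1 + 1) * a p.2) :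
    ∑ k ∈ range (n + 1), a k ≤ exp (∑ j ∈ range n, b (j + 1)) := by
  set A : ℝ → ℝ := fun t => ∑ k ∈ range (n + 1), a k * t ^ k with hA
  set B : ℝ → ℝ := fun t => ∑ j ∈ range n, b (j + 1) * t ^ (j + 1) with hB
  set A' : ℝ → ℝ := fun t => ∑ k ∈ range n, ((k + 1 : ℝ) * a (k + 1)) * t ^ k with hA'
  set B' : ℝ → ℝ := fun t => ∑ j ∈ range n, ((j + 1 : ℝ) * b (j + 1)) * t ^ j with hB'
  have hderA : ∀ t, HasDerivAt A (A' t) t := by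
    intro t
    have h : HasDerivAt A (∑ k ∈ range (n + 1), a k * ((k : ℝ) * t ^ (k - 1))) t :=
      HasDerivAt.fun_sum fun k _ => (hasDerivAt_pow k t).const_mul (a k)
    convert h using 1
    rw [sum_range_succ']
    simp only [Nat.cast_zero, zero_mul, mul_zero, add_zero, hA', Nat.add_sub_cancel]
    exact sum_congr rfl fun k _ => by push_cast; ring
  have hderB : ∀ t, HasDerivAt B (B' t) t := by
    intro t
    have h : HasDerivAt B (∑ j ∈ range n, b (j + 1) * (((j + 1 : ℕ) : ℝ) * t ^ (j + 1 - 1))) t :=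
      HasDerivAt.fun_sum fun j _ => (hasDerivAt_pow (j + 1) t).const_mul (b (j + 1))
    convert h using 1
    exact sum_congr rfl fun k _ => by rw [Nat.add_sub_cancel]; push_cast; ring
  have hle : ∀ t, 0 ≤ t → A' t ≤ B' t * A t := by
    intro t ht
    set g : ℕ × ℕ → ℝ := fun p =>
      ((p.1 + 1 : ℝ) * b (p.1 + 1)) * t ^ p.1 * (a p.2 * t ^ p.2) with hg
    have hgnn : ∀ p, 0 ≤ g p := fun p =>
      mul_nonneg (mul_nonneg (mul_nonneg (by positivity) (hb _)) (pow_nonneg ht _))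
        (mul_nonneg (ha _) (pow_nonneg ht _))
    have hprod : B' t * A t = ∑ p ∈ range n ×ˢ range (n + 1), g p := by
      rw [sum_product, hA, hB', sum_mul_sum]
    have hfib : ∑ k ∈ range n, ∑ p ∈ antidiagonal k, g p =
        ∑ p ∈ (range n ×ˢ range (n + 1)).filter (fun p => p.1 + p.2 ∈ range n), g p := by
      rw [← sum_fiberwise_of_maps_to (g := fun p : ℕ × ℕ => p.1 + p.2) (t := range n)
        (fun p hp => (mem_filter.1 hp).2)]
      refine sum_congr rfl fun k hk => sum_congr ?_ fun _ _ => rfl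
      ext p
      simp only [HasAntidiagonal.mem_antidiagonal, mem_filter, mem_product, mem_range] at hk ⊢
      omega
    calc A' t ≤ ∑ k ∈ range n, ∑ p ∈ antidiagonal k, g p := by
          refine sum_le_sum fun k hk => ?_
          refine (mul_le_mul_of_nonneg_right (hrec k (mem_range.1 hk)) (pow_nonneg ht k)).trans
            (le_of_eq ?_)
          rw [sum_mul]
          refine sum_congr rfl fun p hp => ?_
          rw [hg, ← mem_antidiagonal.1 hp, pow_add]
          ring
      _ ≤ B' t * A t := by
          rw [hfib, hprod]
          exact sum_le_sum_of_subset_of_nonneg (filter_subset _ _) fun p _ _ => hgnn p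
  have hderG : ∀ t, HasDerivAt (fun t => A t * exp (-B t))
      (A' t * exp (-B t) + A t * (exp (-B t) * -B' t)) t :=
    fun t => (hderA t).mul (hderB t).neg.exp
  have hanti : AntitoneOn (fun t => A t * exp (-B t)) (Set.Ici 0) := by
    refine antitoneOn_of_deriv_nonpos (convex_Ici 0)
      (fun t _ => (hderG t).continuousAt.continuousWithinAt)
      (fun t _ => (hderG t).differentiableAt.differentiableWithinAt) fun t ht => ?_
    rw [interior_Ici] at ht
    rw [(hderG t).deriv]
    have := mul_nonneg (sub_nonneg.2 (hle t (Set.mem_Ioi.1 ht).le)) (exp_pos (-B t)).le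
    linarith
  have h01 := hanti (Set.mem_Ici.2 le_rfl) (Set.mem_Ici.2 zero_le_one) zero_le_one
  have hA0 : A 0 = a 0 := by
    simp [hA, sum_range_succ']
  have hB0 : B 0 = 0 := by
    simp [hB]
  have hA1 : A 1 = ∑ k ∈ range (n + 1), a k := by simp [hA]
  have hB1 : B 1 = ∑ j ∈ range n, b (j + 1) := by simp [hB]
  simp only [hA0, hB0, hA1, hB1, neg_zero, exp_zero, mul_one] at h01
  rw [exp_neg, ← div_eq_mul_inv, div_le_iff₀ (exp_pos _)] at h01
  nlinarith [exp_pos (∑ j ∈ range n, b (j + 1))]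

/-- Taylor polynomials of `exp` at `-x` with `0 ≤ x` alternate around `exp (-x)`. -/
theorem neg_one_pow_mul_expSum_sub_exp_nonneg (n : ℕ) {x : ℝ} (hx : 0 ≤ x) :
    0 ≤ (-1 : ℝ) ^ n * (∑ k ∈ range (n + 1), (-x) ^ k / (k.factorial : ℝ) - exp (-x)) := by
  induction n generalizing x with
  | zero => simpa using hx
  | succ n ih =>
    set D : ℝ → ℝ := fun x => (-1 : ℝ) ^ (n + 1) *
      (∑ k ∈ range (n + 2), (-x) ^ k / (k.factorial : ℝ) - exp (-x)) with hD
    have hder : ∀ x, HasDerivAt D ((-1 : ℝ) ^ n *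
        (∑ k ∈ range (n + 1), (-x) ^ k / (k.factorial : ℝ) - exp (-x))) x := by
      intro x
      have h1 : HasDerivAt (fun x : ℝ => ∑ k ∈ range (n + 2), (-x) ^ k / (k.factorial : ℝ))
          (∑ k ∈ range (n + 2), (k : ℝ) * (-x) ^ (k - 1) * (-1) / (k.factorial : ℝ)) x :=
        HasDerivAt.fun_sum fun k _ => ((hasDerivAt_neg x).fun_pow k).div_const _
      have h2 := (h1.sub (hasDerivAt_neg x).exp).const_mul ((-1 : ℝ) ^ (n + 1))
      refine h2.congr_deriv ?_
      rw [sum_range_succ' (n := n + 1)]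
      have h3 : ∑ k ∈ range (n + 1),
          ((k + 1 : ℕ) : ℝ) * (-x) ^ (k + 1 - 1) * (-1) / ((k + 1).factorial : ℝ) =
          -∑ k ∈ range (n + 1), (-x) ^ k / (k.factorial : ℝ) := by
        rw [← sum_neg_distrib]
        refine sum_congr rfl fun k _ => ?_
        have : (k.factorial : ℝ) ≠ 0 := by positivity
        rw [Nat.factorial_succ, Nat.add_sub_cancel]
        push_cast
        field_simp
      rw [h3]
      simp only [Nat.cast_zero, zero_mul, zero_div, add_zero]
      ring
    have hmono : MonotoneOn D (Set.Ici 0) := by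
      refine monotoneOn_of_deriv_nonneg (convex_Ici 0)
        (fun t _ => (hder t).continuousAt.continuousWithinAt)
        (fun t _ => (hder t).differentiableAt.differentiableWithinAt) fun t ht => ?_
      rw [interior_Ici] at ht
      rw [(hder t).deriv]
      exact ih (Set.mem_Ioi.1 ht).le
    have h0 : D 0 = 0 := by simp [hD, sum_range_succ']
    exact h0 ▸ hmono (Set.mem_Ici.2 le_rfl) (Set.mem_Ici.2 hx) hx

theorem expSum_nonneg_of_even {n : ℕ} (hn : Even n) (x : ℝ) :
    0 ≤ ∑ k ∈ range (n + 1), x ^ k / (k.factorial : ℝ) := by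
  rcases le_total 0 x with hx | hx
  · exact sum_nonneg fun k _ => by positivity
  · have h := neg_one_pow_mul_expSum_sub_exp_nonneg n (neg_nonneg.2 hx)
    rw [hn.neg_one_pow, one_mul, neg_neg] at h
    linarith [exp_pos x]

theorem exp_sub_le_expSum (n : ℕ) {x c : ℝ} (hx : 0 ≤ x) (hc : 1 ≤ c) :
    exp x - exp (c * x) / c ^ (n + 1) ≤ ∑ k ∈ range (n + 1), x ^ k / (k.factorial : ℝ) := by
  have hexp : ∀ z : ℝ, HasSum (fun k : ℕ => z ^ k / (k.factorial : ℝ)) (exp z) := by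
    intro z
    rw [Real.exp_eq_exp_ℝ]
    exact NormedSpace.expSeries_div_hasSum_exp z
  have hfin : HasSum (fun k => if k ∈ range (n + 1) then x ^ k / (k.factorial : ℝ) else 0)
      (∑ k ∈ range (n + 1), x ^ k / (k.factorial : ℝ)) := by
    have h := hasSum_sum_of_ne_finset_zero
      (f := fun k => if k ∈ range (n + 1) then x ^ k / (k.factorial : ℝ) else 0)
      (s := range (n + 1)) (L := SummationFilter.unconditional ℕ) fun k hk => if_neg hk
    rwa [sum_congr rfl fun k hk => if_pos hk] at h
  have hc0 : 0 < c := by linarith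
  have h := (((hexp (c * x)).div_const (c ^ (n + 1))).sub (hexp x)).add hfin
  have hnn : 0 ≤ exp (c * x) / c ^ (n + 1) - exp x +
      ∑ k ∈ range (n + 1), x ^ k / (k.factorial : ℝ) := by
    refine hasSum_le (fun k => ?_) (hasSum_zero (α := ℝ) (β := ℕ)) h
    split_ifs with hk
    · have : 0 ≤ (c * x) ^ k / (k.factorial : ℝ) / c ^ (n + 1) := by positivity
      linarith
    · have hk : n + 1 ≤ k := by simpa using hk
      have hck : c ^ (n + 1) ≤ c ^ k := pow_le_pow_right₀ hc hk
      rw [add_zero, sub_nonneg, le_div_iff₀ (by positivity), mul_pow, mul_div_assoc, mul_comm]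
      exact mul_le_mul_of_nonneg_right hck (by positivity)
  linarith

theorem factorial_div_two_le_pow {x : ℝ} (hx : 8 ≤ x) {j : ℕ} (hj : (j : ℝ) ≤ x) :
    ((j + 2).factorial : ℝ) / 2 ≤ x ^ j := by
  have hind : ∀ i : ℕ, (i : ℝ) + 4 ≤ x → ((i + 4).factorial : ℝ) / 2 ≤ 12 * x ^ i := by
    intro i
    induction i with
    | zero => intro _; norm_num [Nat.factorial]
    | succ i ih =>
      intro hi
      push_cast at hi
      rw [show i + 1 + 4 = (i + 4) + 1 by ring, Nat.factorial_succ, pow_succ]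
      push_cast
      have h1 := ih (by linarith)
      have h2 : (0 : ℝ) ≤ ((i + 4).factorial : ℝ) / 2 := by positivity
      nlinarith [mul_le_mul h1 (by linarith : (i : ℝ) + 4 + 1 ≤ x) (by positivity) (by positivity)]
  match j, hj with
  | 0, _ => norm_num [Nat.factorial]
  | 1, _ => norm_num [Nat.factorial]; linarith
  | 2, _ => norm_num [Nat.factorial]; nlinarith
  | 3, _ => norm_num [Nat.factorial]; nlinarith [pow_le_pow_left₀ (by norm_num) hx 3]
  | i + 4, hj =>
    push_cast at hj
    have h1 := hind i hj
    rw [show i + 4 + 2 = (i + 5) + 1 by ring, Nat.factorial_succ, Nat.factorial_succ]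
    push_cast
    have h2 : ((i : ℝ) + 5 + 1) * ((i : ℝ) + 4 + 1) ≤ (x + 2) * (x + 1) :=
      mul_le_mul (by linarith) (by linarith) (by positivity) (by linarith)
    have h3 : (x + 2) * (x + 1) * 12 ≤ x ^ 4 := by
      nlinarith [mul_le_mul hx hx (by norm_num) (by linarith), sq_nonneg x,
        sq_nonneg (x ^ 2 - 64)]
    calc ((i : ℝ) + 5 + 1) * (((i : ℝ) + 4 + 1) * ((i + 4).factorial : ℝ)) / 2
        = ((i : ℝ) + 5 + 1) * ((i : ℝ) + 4 + 1) * (((i + 4).factorial : ℝ) / 2) := by ring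
      _ ≤ (x + 2) * (x + 1) * (12 * x ^ i) :=
          mul_le_mul h2 h1 (by positivity) (by positivity)
      _ = (x + 2) * (x + 1) * 12 * x ^ i := by ring
      _ ≤ x ^ 4 * x ^ i := mul_le_mul_of_nonneg_right h3 (by positivity)
      _ = x ^ (i + 4) := by ring

/-- A Taylor polynomial of `exp` of degree exceeding `x` is, at `2 * x / 5`, almost as large as
`exp (2 * x / 5)`. -/
theorem exp_le_expSum_two_fifths {x : ℝ} (hx : 8 ≤ x) {n : ℕ} (hn : x ≤ n) :
    exp (23 * x / 60) ≤ ∑ k ∈ range (n + 1), (2 * x / 5) ^ k / (k.factorial : ℝ) := by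
  refine le_trans ?_ (exp_sub_le_expSum n (by linarith : 0 ≤ 2 * x / 5)
    (by norm_num : (1 : ℝ) ≤ 5 / 2))
  have hbase : exp (9 / 10) ≤ 5 / 2 := by
    have h1 : exp (9 / 10) ^ 10 ≤ (5 / 2 : ℝ) ^ 10 := by
      rw [← exp_nat_mul]
      have h2 : exp (((10 : ℕ) : ℝ) * (9 / 10)) = exp 1 ^ 9 := by
        rw [← exp_nat_mul]; norm_num
      rw [h2]
      have h3 : exp 1 ≤ 2.7182818286 := exp_one_lt_d9.le
      exact (pow_le_pow_left₀ (exp_pos 1).le h3 9).trans (by norm_num)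
    exact le_of_pow_le_pow_left₀ (by norm_num) (by norm_num) h1
  have hpow : 5 / 2 * exp (9 * x / 10) ≤ (5 / 2 : ℝ) ^ (n + 1) := by
    rw [pow_succ']
    refine mul_le_mul_of_nonneg_left ?_ (by norm_num)
    refine le_trans ?_ (pow_le_pow_left₀ (exp_pos _).le hbase n)
    rw [← exp_nat_mul, exp_le_exp]
    linarith
  have htail : exp (5 / 2 * (2 * x / 5)) / (5 / 2 : ℝ) ^ (n + 1) ≤
      exp (2 * x / 5) * (2 / 17) := by
    rw [div_le_iff₀ (by positivity)]
    have h1 : exp (3 * x / 10) ≥ 17 / 5 := by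
      linarith [add_one_le_exp (3 * x / 10)]
    have h2 : exp (5 / 2 * (2 * x / 5)) * exp (3 * x / 10) =
        exp (2 * x / 5) * exp (9 * x / 10) := by
      rw [← exp_add, ← exp_add]; ring_nf
    have h3 := exp_pos (5 / 2 * (2 * x / 5))
    have h4 := mul_le_mul_of_nonneg_left hpow (exp_pos (2 * x / 5)).le
    nlinarith
  have hmain : exp (23 * x / 60) ≤ exp (2 * x / 5) * (15 / 17) := by
    have h1 : exp (x / 60) ≥ 17 / 15 := by linarith [add_one_le_exp (x / 60)]
    have h2 : exp (2 * x / 5) = exp (23 * x / 60) * exp (x / 60) := by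
      rw [← exp_add]; ring_nf
    have h3 := exp_pos (23 * x / 60)
    nlinarith
  linarith

theorem exp_div_four_le_one_add {x : ℝ} (h0 : 0 ≤ x) (h8 : x ≤ 8) : exp (x / 4) ≤ 1 + x := by
  have hconv := convexOn_exp.2 (Set.mem_univ (0 : ℝ)) (Set.mem_univ (2 : ℝ))
    (by linarith : 0 ≤ 1 - x / 8) (by linarith : 0 ≤ x / 8) (by ring)
  simp only [smul_eq_mul, mul_zero, zero_add, exp_zero, mul_one] at hconv
  have h2 : exp 2 ≤ 9 := by
    have h1 : exp 1 ≤ 3 := by linarith [exp_one_lt_d9]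
    have : exp 2 = exp 1 * exp 1 := by rw [← exp_add]; norm_num
    nlinarith [exp_pos 1]
  rw [show x / 8 * 2 = x / 4 by ring] at hconv
  nlinarith

end Exponential

section TailBounds

variable {Ω : Type*} [MeasurableSpace Ω] {μ : Measure Ω} {Y : Ω → ℝ}

theorem integrable_pow_of_abs (hY : Measurable Y)
    (hmom : ∀ n : ℕ, Integrable (fun ω => |Y ω| ^ n) μ) (n : ℕ) :
    Integrable (fun ω => Y ω ^ n) μ :=
  (hmom n).mono' (hY.pow_const n).aestronglyMeasurable
    (Filter.Eventually.of_forall fun ω => by rw [Real.norm_eq_abs, abs_pow])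

theorem measure_le_le_integral_div [IsFiniteMeasure μ] {f : Ω → ℝ}
    (hf : Integrable f μ) (hf0 : ∀ ω, 0 ≤ f ω)
    {c : ℝ} (hc : 0 < c) {y : ℝ} (h : ∀ ω, y ≤ Y ω → c ≤ f ω) :
    (μ {ω | y ≤ Y ω}).toReal ≤ (∫ ω, f ω ∂μ) / c := by
  rw [le_div_iff₀ hc, mul_comm]
  refine le_trans ?_ (mul_meas_ge_le_integral_of_nonneg (Filter.Eventually.of_forall hf0) hf c)
  exact mul_le_mul_of_nonneg_left
    (ENNReal.toReal_mono (measure_ne_top _ _) (measure_mono fun ω hω => h ω hω)) hc.le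

/-- Cantelli's inequality. -/
theorem cantelli [IsProbabilityMeasure μ] (hY : Measurable Y)
    (hmom : ∀ n : ℕ, Integrable (fun ω => |Y ω| ^ n) μ)
    (hmean : ∫ ω, Y ω ∂μ = 0) {H y : ℝ} (hH : 0 < H) (hy : 0 < y)
    (hvar : ∫ ω, Y ω ^ 2 ∂μ ≤ H) :
    (μ {ω | y ≤ Y ω}).toReal ≤ 1 / (1 + y ^ 2 / H) := by
  have h2 := integrable_pow_of_abs hY hmom 2
  have h1 : Integrable Y μ := by simpa using integrable_pow_of_abs hY hmom 1
  set s := H / y with hs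
  have hs0 : 0 < s := div_pos hH hy
  have hint : ∫ ω, (Y ω + s) ^ 2 ∂μ = ∫ ω, Y ω ^ 2 ∂μ + s ^ 2 := by
    have heq : ∀ ω, (Y ω + s) ^ 2 = Y ω ^ 2 + (2 * s * Y ω + s ^ 2) := fun ω => by ring
    simp_rw [heq]
    rw [integral_add h2 (show Integrable (fun ω => 2 * s * Y ω + s ^ 2) μ from
      (h1.const_mul _).add (integrable_const _)),
      integral_add (h1.const_mul _) (integrable_const _), integral_const_mul, hmean]
    simp
  have hi : Integrable (fun ω => (Y ω + s) ^ 2) μ := by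
    have heq : (fun ω => (Y ω + s) ^ 2) = fun ω => Y ω ^ 2 + (2 * s * Y ω + s ^ 2) := by
      ext ω; ring
    rw [heq]
    exact h2.add ((h1.const_mul _).add (integrable_const _))
  have h := measure_le_le_integral_div (Y := Y) hi (fun ω => sq_nonneg _)
    (c := (y + s) ^ 2) (by positivity) (y := y)
    fun ω hω => pow_le_pow_left₀ (by positivity) (by linarith) 2
  refine h.trans ?_
  rw [hint]
  calc (∫ ω, Y ω ^ 2 ∂μ + s ^ 2) / (y + s) ^ 2 ≤ (H + s ^ 2) / (y + s) ^ 2 := by gcongr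
    _ = 1 / (1 + y ^ 2 / H) := by
      have : y ^ 2 + H ≠ 0 := by positivity
      rw [hs]
      field_simp
      ring

/-- The partial sums of the moment series are bounded by the exponential of the partial sums
of the series of absolute values of the cumulants. -/
theorem sum_moments_le_exp_sum_cumulants (m : ℕ → ℝ) (hm : m 0 = 1) {h : ℝ} (hh : 0 ≤ h)
    (n : ℕ) :
    ∑ k ∈ range (n + 1), m k * h ^ k / (k.factorial : ℝ) ≤
      exp (∑ j ∈ range n, |cumulantOfMoments m (j + 1)| * h ^ (j + 1) /
        ((j + 1).factorial : ℝ)) := by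
  refine le_trans (sum_le_sum fun k _ => ?_) (sum_range_le_exp_of_recursion
    (a := fun k => |m k| * h ^ k / (k.factorial : ℝ))
    (b := fun k => |cumulantOfMoments m k| * h ^ k / (k.factorial : ℝ)) n
    (fun k => by positivity) (fun k => by positivity) (by simp [hm]) fun k _ => ?_)
  · have := le_abs_self (m k)
    gcongr
  · have hfac : ∀ i : ℕ, ∀ c : ℝ, (i + 1 : ℝ) * (c / ((i + 1).factorial : ℝ)) =
        c / (i.factorial : ℝ) := by
      intro i c
      have : (i.factorial : ℝ) ≠ 0 := by positivity
      rw [Nat.factorial_succ]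
      push_cast
      field_simp
    simp only [hfac]
    have hrec := congrArg abs (moment_cumulant_recursion m hm k)
    rw [abs_div, Nat.abs_cast] at hrec
    rw [mul_div_right_comm, hrec]
    refine (mul_le_mul_of_nonneg_right (abs_sum_le_sum_abs _ _) (by positivity)).trans
      (le_of_eq ?_)
    rw [sum_mul]
    refine sum_congr rfl fun p hp => ?_
    rw [← HasAntidiagonal.mem_antidiagonal.1 hp]
    simp only [abs_mul, abs_div, Nat.abs_cast]
    ring

/-- The tail bound in terms of a lower bound `x` of both quantities in the exponent. -/
theorem tail_le_exp_of_cumulants [IsProbabilityMeasure μ] (hY : Measurable Y)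
    (hmom : ∀ n : ℕ, Integrable (fun ω => |Y ω| ^ n) μ) (hmean : ∫ ω, Y ω ∂μ = 0)
    {γ H Δ x y : ℝ} (hγ : 0 ≤ γ) (hH : 0 < H) (hΔ : 0 < Δ)
    (hcum : ∀ k : ℕ, 2 ≤ k →
      |cumulantRV μ Y k| ≤ ((Nat.factorial k : ℝ) / 2) ^ (1 + γ) * H / Δ ^ (k - 2))
    (hy : 0 < y) (hx : 8 ≤ x) (hxH : x * H ≤ y ^ 2) (hxΔ : x ^ (1 + γ) ≤ Δ * y) :
    (μ {ω | y ≤ Y ω}).toReal ≤ exp (-(1 / 4) * x) := by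
  have hx0 : 0 < x := by linarith
  set m : ℕ → ℝ := fun k => ∫ ω, Y ω ^ k ∂μ with hm
  have hm0 : m 0 = 1 := by simp [hm]
  have hm1 : m 1 = 0 := by simpa [hm] using hmean
  have hκ1 : cumulantOfMoments m 1 = 0 := by
    have h := moment_cumulant_recursion m hm0 0
    simpa [hm0, hm1] using h.symm
  obtain ⟨N, hNx, hxN, heven⟩ : ∃ N : ℕ, (N : ℝ) ≤ x + 1 ∧ x ≤ ((N + 1 : ℕ) : ℝ) ∧
      Even (N + 1) := by
    have h1 := Nat.floor_le (by positivity : 0 ≤ x / 2)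
    have h2 := Nat.lt_floor_add_one (x / 2)
    refine ⟨2 * ⌊x / 2⌋₊ + 1, ?_, ?_, ⟨⌊x / 2⌋₊ + 1, by ring⟩⟩ <;> push_cast <;> linarith
  obtain ⟨h, hh⟩ : ∃ h, h = 2 * x / 5 / y := ⟨_, rfl⟩
  have hh0 : 0 < h := hh ▸ by positivity
  have hHh : H * h ^ 2 ≤ (2 / 5) ^ 2 * x := by
    rw [hh, div_pow, ← mul_div_assoc, div_le_iff₀ (by positivity)]
    nlinarith
  have hΔh : x ^ γ * (h / Δ) ≤ 2 / 5 := by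
    rw [hh, div_div, ← mul_div_assoc, div_le_iff₀ (by positivity)]
    rw [rpow_add hx0, rpow_one] at hxΔ
    linarith
  have hterm : ∀ j < N, |cumulantOfMoments m (j + 2)| * h ^ (j + 2) / ((j + 2).factorial : ℝ) ≤
      2 / 25 * x * (2 / 5) ^ j := by
    intro j hj
    have hjx : (j : ℝ) ≤ x := by
      have : ((j + 1 : ℕ) : ℝ) ≤ N := Nat.cast_le.2 hj
      push_cast at this
      linarith
    have hc : |cumulantOfMoments m (j + 2)| ≤ _ := hcum (j + 2) (by omega)
    set F : ℝ := ((j + 2).factorial : ℝ) with hF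
    have hF0 : 0 < F := by positivity
    have hFγ : (F / 2) ^ γ ≤ (x ^ γ) ^ j := by
      rw [← rpow_natCast, ← rpow_mul hx0.le, mul_comm γ, rpow_mul hx0.le, rpow_natCast]
      exact rpow_le_rpow (by positivity) (factorial_div_two_le_pow hx hjx) hγ
    rw [rpow_add (by positivity), rpow_one, Nat.add_sub_cancel] at hc
    calc |cumulantOfMoments m (j + 2)| * h ^ (j + 2) / F
        ≤ F / 2 * (F / 2) ^ γ * H / Δ ^ j * h ^ (j + 2) / F := by gcongr
      _ = 1 / 2 * (H * h ^ 2) * ((F / 2) ^ γ * (h / Δ) ^ j) := by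
          rw [div_pow h Δ j, pow_add]; field_simp
      _ ≤ 1 / 2 * ((2 / 5) ^ 2 * x) * ((x ^ γ) ^ j * (h / Δ) ^ j) := by gcongr
      _ = 2 / 25 * x * (x ^ γ * (h / Δ)) ^ j := by rw [mul_pow]; ring
      _ ≤ 2 / 25 * x * (2 / 5) ^ j := by gcongr
  have hsum : ∑ j ∈ range (N + 1), |cumulantOfMoments m (j + 1)| * h ^ (j + 1) /
      ((j + 1).factorial : ℝ) ≤ 2 * x / 15 := by
    rw [sum_range_succ', zero_add, hκ1, abs_zero, zero_mul, zero_div, add_zero]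
    refine (sum_le_sum fun j hj => hterm j (mem_range.1 hj)).trans ?_
    rw [← mul_sum, geom_sum_eq (by norm_num)]
    have h1 : (0 : ℝ) ≤ x * (2 / 5) ^ N := by positivity
    have h2 : ((2 / 5 : ℝ) ^ N - 1) / (2 / 5 - 1) = 5 / 3 * (1 - (2 / 5) ^ N) := by
      norm_num
      ring
    rw [h2]
    linarith
  have hmgf := (sum_moments_le_exp_sum_cumulants m hm0 hh0.le (N + 1)).trans (exp_le_exp.2 hsum)
  have hint : ∀ k ∈ range (N + 1 + 1),
      Integrable (fun ω => (h * Y ω) ^ k / (k.factorial : ℝ)) μ := by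
    intro k _
    simp_rw [mul_pow]
    exact ((integrable_pow_of_abs hY hmom k).const_mul _).div_const _
  have hE : ∫ ω, ∑ k ∈ range (N + 1 + 1), (h * Y ω) ^ k / (k.factorial : ℝ) ∂μ =
      ∑ k ∈ range (N + 1 + 1), m k * h ^ k / (k.factorial : ℝ) := by
    rw [integral_finsetSum _ hint]
    refine sum_congr rfl fun k _ => ?_
    simp_rw [mul_pow]
    rw [integral_div, integral_const_mul, mul_comm]
  have hlow := exp_le_expSum_two_fifths hx hxN
  have hpos : 0 < ∑ k ∈ range (N + 1 + 1), (2 * x / 5) ^ k / (k.factorial : ℝ) :=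
    (exp_pos _).trans_le hlow
  have htail := measure_le_le_integral_div (Y := Y) (integrable_finsetSum _ hint)
    (fun ω => expSum_nonneg_of_even heven (h * Y ω)) hpos (y := y) fun ω hω => by
      have hyω : 2 * x / 5 ≤ h * Y ω := by
        have : h * y = 2 * x / 5 := by rw [hh]; field_simp
        exact this ▸ mul_le_mul_of_nonneg_left hω hh0.le
      gcongr
  rw [hE] at htail
  calc _ ≤ _ := htail
    _ ≤ exp (2 * x / 15) / exp (23 * x / 60) := by gcongr
    _ = exp (-(1 / 4) * x) := by rw [← exp_sub]; ring_nf

end TailBounds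

/-- The lemma of Bentkus and Rudzkis (Lemma 3.6): if `Y` is centered, has finite absolute
moments of all orders, and `|c^k[Y]| ≤ (k!/2)^{1+γ} H/Δ^{k−2}` for all `k ≥ 2`, then for
all `y ≥ 0`, `P(Y ≥ y) ≤ exp(−(1/4) min{y²/H, (Δy)^{1/(1+γ)}})`. -/
theorem stmt6 {Ω : Type} [MeasurableSpace Ω] (μ : Measure Ω) [IsProbabilityMeasure μ]
    (Y : Ω → ℝ) (hYmeas : Measurable Y)
    (hmom : ∀ n : ℕ, Integrable (fun ω => |Y ω| ^ n) μ)
    (hmean : ∫ ω, Y ω ∂μ = 0)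
    (γ H Δ : ℝ) (hγ : 0 ≤ γ) (hH : 0 < H) (hΔ : 0 < Δ)
    (hcum : ∀ k : ℕ, 2 ≤ k →
      |cumulantRV μ Y k| ≤ ((Nat.factorial k : ℝ) / 2) ^ (1 + γ) * H / Δ ^ (k - 2)) :
    ∀ y : ℝ, 0 ≤ y →
      (μ {ω | y ≤ Y ω}).toReal
        ≤ Real.exp (-(1 / 4) * min (y ^ 2 / H) ((Δ * y) ^ (1 / (1 + γ)))) := by
  intro y hy
  rcases hy.eq_or_lt with rfl | hy
  · have hγ' : 1 / (1 + γ) ≠ 0 := by positivity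
    rw [mul_zero, zero_rpow hγ', zero_pow two_ne_zero, zero_div, min_self, mul_zero, exp_zero]
    exact measureReal_le_one
  set x := min (y ^ 2 / H) ((Δ * y) ^ (1 / (1 + γ))) with hx
  have hxH : x ≤ y ^ 2 / H := min_le_left _ _
  have hx0 : 0 ≤ x := le_min (by positivity) (by positivity)
  rcases le_total x 8 with h8 | h8
  · have hvar : ∫ ω, Y ω ^ 2 ∂μ ≤ H := by
      have hrec := moment_cumulant_recursion (fun k => ∫ ω, Y ω ^ k ∂μ) (by simp) 1
      simp only [Finset.Nat.antidiagonal_succ, Finset.Nat.antidiagonal_zero] at hrec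
      have h2 := (le_abs_self _).trans (hcum 2 le_rfl)
      have h2' : cumulantOfMoments (fun k => ∫ ω, Y ω ^ k ∂μ) 2 ≤ H := by
        have hF : (((2 : ℕ).factorial : ℝ) / 2) ^ (1 + γ) * H / Δ ^ (2 - 2) = H := by
          simp [Nat.factorial]
        exact h2.trans_eq hF
      have hrec' : ∫ ω, Y ω ^ 2 ∂μ = cumulantOfMoments (fun k => ∫ ω, Y ω ^ k ∂μ) 2 := by
        simpa [hmean] using hrec
      exact hrec'.trans_le h2'
    refine (cantelli hYmeas hmom hmean hH hy hvar).trans ?_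
    rw [show -(1 / 4) * x = -(x / 4) by ring, exp_neg, one_div]
    refine inv_anti₀ (exp_pos _) ?_
    exact (exp_div_four_le_one_add hx0 h8).trans (by linarith)
  · refine tail_le_exp_of_cumulants hYmeas hmom hmean hγ hH hΔ hcum hy h8
      ((le_div_iff₀ hH).1 hxH) ?_
    have h := rpow_le_rpow hx0 (min_le_right _ _ : x ≤ (Δ * y) ^ (1 / (1 + γ)))
      (by positivity : 0 ≤ 1 + γ)
    rwa [← rpow_mul (by positivity), one_div_mul_cancel (by positivity), rpow_one] at h
end

section
/- Let d ≥ 1, p ≥ 2, t > 0, let D be a tree on the vertex set {1,…,p}, and fix y ∈ ℝ^d. Then the set { (z_2,…,z_p) ∈ (ℝ^d)^{p−1} : setting v_1 := y and v_i := z_i for i = 2,…,p, one has ‖v_i − v_j‖ < t for every edge {i,j} of D } has (p−1)d-dimensional Lebesgue measure at most t^{(p−1)d} V_d^{p−1}, where V_d is the Lebesgue measure of the unit ball in ℝ^d and ‖·‖ is the Euclidean norm. -/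
open MeasureTheory Metric

/-- If the centre `c i z` depends only on the coordinates of `z` of rank smaller than that of `i`,
then the points `z` whose every coordinate `z i` is within `t` of `c i z` have volume at most
that of a product of balls of radius `t`. -/
theorem volume_forall_dist_lt_le {E : Type*} [NormedAddCommGroup E] [MeasureSpace E]
    [BorelSpace E] [SecondCountableTopology E]
    [SigmaFinite (volume : Measure E)] [(volume : Measure E).IsAddLeftInvariant]
    (t : ℝ) (n : ℕ) (r : Fin n → ℕ) (c : Fin n → (Fin n → E) → E)
    (hcm : ∀ i, Measurable (c i))
    (hc : ∀ i z z', (∀ j, r j < r i → z j = z' j) → c i z = c i z') :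
    volume {z : Fin n → E | ∀ i, dist (z i) (c i z) < t} ≤ volume (ball (0 : E) t) ^ n := by
  induction n with
  | zero => simp [volume_pi]
  | succ n ih =>
    obtain ⟨i, hi⟩ := Finite.exists_max r
    have hins : Measurable fun w : Fin n → E => (i.insertNth 0 w : Fin (n + 1) → E) := by
      refine measurable_pi_iff.2 fun j => ?_
      induction j using i.succAboveCases with
      | x => simp
      | p j => simpa using measurable_pi_apply j
    have hcS := ih (r ∘ i.succAbove) (fun j w => c (i.succAbove j) (i.insertNth 0 w))
      (fun j => (hcm _).comp hins) (by
        intro j z z' h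
        refine hc _ _ _ fun k hk => ?_
        induction k using i.succAboveCases with
        | x => simp
        | p k => simpa using h k hk)
    set S : Set (Fin n → E) :=
      {w | ∀ j, dist (w j) (c (i.succAbove j) (i.insertNth 0 w)) < t} with hS
    have hSm : MeasurableSet S := by
      rw [hS, Set.ofPred_forall]
      exact MeasurableSet.iInter fun j => measurableSet_lt
        ((measurable_pi_apply j).dist ((hcm _).comp hins)) measurable_const
    let T : Set (E × (Fin n → E)) :=
      {q | q.2 ∈ S ∧ dist q.1 (c i (i.insertNth 0 q.2)) < t}
    have hTm : MeasurableSet T :=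
      (measurable_snd hSm).inter (measurableSet_lt
        (measurable_fst.dist (((hcm i).comp hins).comp measurable_snd)) measurable_const)
    have hsub : {z : Fin (n + 1) → E | ∀ i, dist (z i) (c i z) < t} ⊆
        MeasurableEquiv.piFinSuccAbove (fun _ => E) i ⁻¹' T := by
      intro z hz
      have hz' : ∀ j, c j (i.insertNth 0 (i.removeNth z)) = c j z := by
        intro j
        refine hc _ _ _ fun k hk => ?_
        induction k using i.succAboveCases with
        | x => exact absurd hk (hi j).not_gt
        | p k => simp [Fin.removeNth]
      refine ⟨fun j => ?_, ?_⟩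
      · have := hz (i.succAbove j)
        rw [← hz'] at this
        exact this
      · have := hz i
        rw [← hz'] at this
        exact this
    calc _ ≤ _ := measure_mono hsub
      _ = volume T := (volume_preserving_piFinSuccAbove (fun _ => E) i).measure_preimage
          hTm.nullMeasurableSet
      _ = ∫⁻ w, volume ((fun x => (x, w)) ⁻¹' T) := Measure.prod_apply_symm hTm
      _ ≤ ∫⁻ w, S.indicator (fun _ => volume (ball (0 : E) t)) w := by
          refine lintegral_mono fun w => ?_
          by_cases hw : w ∈ S
          · rw [Set.indicator_of_mem hw]
            refine (measure_mono (t := ball (c i (i.insertNth 0 w)) t) fun x hx => hx.2).trans ?_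
            rw [← measure_preimage_add volume (c i (i.insertNth 0 w)), preimage_add_ball, sub_self]
          · rw [Set.indicator_of_notMem hw]
            refine (measure_mono_null (t := ∅) (fun x hx => hw hx.1) measure_empty).le
      _ = volume (ball (0 : E) t) * volume S := by rw [lintegral_indicator_const hSm]
      _ ≤ volume (ball (0 : E) t) * volume (ball (0 : E) t) ^ n := by gcongr
      _ = _ := (pow_succ' _ _).symm

/-- In a connected graph, every vertex other than `u` has a neighbour closer to `u`. -/
theorem SimpleGraph.Connected.exists_adj_dist_lt {V : Type*} {G : SimpleGraph V}
    (hG : G.Connected) {u v : V} (h : v ≠ u) : ∃ w, G.Adj v w ∧ G.dist w u < G.dist v u := by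
  obtain ⟨p, hp⟩ := hG.exists_walk_length_eq_dist v u
  cases p with
  | nil => exact absurd rfl h
  | cons hadj q =>
    refine ⟨_, hadj, ?_⟩
    rw [← hp, SimpleGraph.Walk.length_cons]
    exact Nat.lt_succ_of_le (SimpleGraph.dist_le q)

/-- Lemma on the volume of tree-constrained configurations: for `d ≥ 1`, `p = n+1 ≥ 2`,
`t > 0`, a tree `D` on the vertex set `{1,…,p}` and a fixed point `y ∈ ℝ^d`, the set of
`(z_2,…,z_p) ∈ (ℝ^d)^{p−1}` such that, setting `v_1 := y` and `v_i := z_i` for `i ≥ 2`,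
`‖v_i − v_j‖ < t` for every edge `{i,j}` of `D`, has `(p−1)d`-dimensional Lebesgue measure
at most `t^{(p−1)d} V_d^{p−1}`, where `V_d` denotes the volume of the unit ball of `ℝ^d`. -/
theorem stmt10 (d n : ℕ) (hd : 1 ≤ d) (hn : 1 ≤ n) (t : ℝ) (ht : 0 < t)
    (D : SimpleGraph (Fin (n + 1))) (hD : D.IsTree)
    (y : EuclideanSpace ℝ (Fin d)) :
    volume {z : Fin n → EuclideanSpace ℝ (Fin d) |
        ∀ i j : Fin (n + 1), D.Adj i j →
          dist ((Fin.cons y z : Fin (n + 1) → EuclideanSpace ℝ (Fin d)) i)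
            ((Fin.cons y z : Fin (n + 1) → EuclideanSpace ℝ (Fin d)) j) < t}
      ≤ ENNReal.ofReal (t ^ (n * d)) *
          (volume (ball (0 : EuclideanSpace ℝ (Fin d)) 1)) ^ n := by
  choose p hadj hlt using fun i : Fin n =>
    hD.connected.exists_adj_dist_lt (u := 0) (Fin.succ_ne_zero i)
  have key := volume_forall_dist_lt_le (E := EuclideanSpace ℝ (Fin d)) t n
    (fun i => D.dist i.succ 0)
    (fun i z => (Fin.cons y z : Fin (n + 1) → EuclideanSpace ℝ (Fin d)) (p i))
    (fun i => by
      induction p i using Fin.cases with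
      | zero => simp
      | succ j => simpa using measurable_pi_apply j)
    (fun i z z' h => by
      have hi := hlt i
      generalize p i = k at hi
      induction k using Fin.cases with
      | zero => rfl
      | succ j => simpa using h j hi)
  refine (measure_mono fun z hz i => ?_).trans (key.trans_eq ?_)
  · exact hz i.succ (p i) (hadj i)
  · rw [Measure.addHaar_ball_of_pos volume 0 ht, mul_pow, finrank_euclideanSpace_fin,
      ← ENNReal.ofReal_pow (by positivity), ← pow_mul, mul_comm d n]
end

section
/- Let d ≥ 1, p ≥ 2, t > 0 and let κ : ℝ^d → [0,∞) be a bounded probability density (∫_{ℝ^d} κ(x) dx = 1). Then ∫_{{x ∈ (ℝ^d)^p : δ(x) < t}} κ(x_1)⋯κ(x_p) dx ≤ p^{p−2} t^{(p−1)d} V_d^{p−1} ‖κ‖_∞^{p−1}, where V_d is the Lebesgue measure of the unit ball in ℝ^d and ‖κ‖_∞ is the essential supremum of κ. -/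
open MeasureTheory Metric

/-- The maximal separation `δ(x)` of a configuration `x = (x_1,…,x_p) ∈ (ℝ^d)^p`:
the maximum, over all partitions of `{1,…,p}` into two nonempty sets `(S,T)`, of
`min_{s∈S, u∈T} ‖x_s − x_u‖`. -/
noncomputable def maxSep {p d : ℕ} (x : Fin p → EuclideanSpace ℝ (Fin d)) : ℝ :=
  sSup {r : ℝ | ∃ S : Finset (Fin p), S.Nonempty ∧ Sᶜ.Nonempty ∧
    r = sInf {s : ℝ | ∃ i ∈ S, ∃ j ∈ Sᶜ, s = dist (x i) (x j)}}

/-- Every point of `x` is joined to a root `y r` by a path in `x` whose steps are shorter than `t`,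
expressed by cuts: every nonempty block of `x` has a point at distance less than `t` from a root
or from a point outside the block. -/
def JoinedToRoots {E ι R : Type} [Dist E] (t : ℝ) (y : R → E) (x : ι → E) : Prop :=
  ∀ A : Finset ι, A.Nonempty →
    ∃ i ∈ A, (∃ r, dist (x i) (y r) < t) ∨ ∃ j ∉ A, dist (x i) (x j) < t

theorem isOpen_joinedToRoots {E ι R : Type} [PseudoMetricSpace E] [Fintype ι] (t : ℝ) :
    IsOpen {q : (R → E) × (ι → E) | JoinedToRoots t q.1 q.2} := by
  simp only [JoinedToRoots, Set.ofPred_forall, Set.ofPred_exists, Set.ofPred_and, Set.ofPred_or]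
  refine isOpen_iInter_of_finite fun A => isOpen_iInter_of_finite fun _ =>
    isOpen_iUnion fun i => isOpen_const.inter (IsOpen.union ?_ ?_)
  · exact isOpen_iUnion fun r => isOpen_lt (by fun_prop) continuous_const
  · exact isOpen_iUnion fun j => 
      (isOpen_iInter_of_finite fun _ => isOpen_const).inter
        (isOpen_lt (by fun_prop) continuous_const)

/-- The points of `x` within distance `t` of a root serve as roots for the remaining points. -/
theorem JoinedToRoots.restrict {E ι R : Type} [Dist E] [Fintype ι] {t : ℝ} {y : R → E} {x : ι → E}
    (h : JoinedToRoots t y x) {K : Finset ι} (hK : ∀ i, i ∈ K ↔ ∃ r, dist (x i) (y r) < t) :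
    JoinedToRoots t (fun i : {i // i ∈ K} => x i) (fun i : {i // i ∉ K} => x i) := by
  classical
  intro A hA
  obtain ⟨i, hi, hi'⟩ := h (A.map (Function.Embedding.subtype _)) (by simpa using hA)
  obtain ⟨⟨i, hiK⟩, hiA, rfl⟩ := Finset.mem_map.1 hi
  refine ⟨⟨i, hiK⟩, hiA, ?_⟩
  rcases hi' with hr | ⟨j, hj, hd⟩
  · exact absurd ((hK i).2 hr) hiK
  · by_cases hjK : j ∈ K
    · exact Or.inl ⟨⟨j, hjK⟩, hd⟩
    · exact Or.inr ⟨⟨j, hjK⟩, fun hjA => hj (Finset.mem_map.2 ⟨_, hjA, rfl⟩), hd⟩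

/-- The number of forests on `n + r` labelled vertices whose components are rooted at `r`
prescribed vertices. -/
def rootedForestCount (n r : ℕ) : ℕ := if n = 0 then 1 else r * (n + r) ^ (n - 1)

theorem sum_choose_mul_rootedForestCount (m r : ℕ) :
    ∑ k ∈ Finset.range (m + 2), (m + 1).choose k * (r ^ k * rootedForestCount (m + 1 - k) k) =
      rootedForestCount (m + 1) r := by
  rw [Finset.sum_range_succ']
  have key : ∀ j ∈ Finset.range (m + 1),
      (m + 1).choose (j + 1) * (r ^ (j + 1) * rootedForestCount (m + 1 - (j + 1)) (j + 1)) =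
        r * (r ^ j * (m + 1) ^ (m - j) * m.choose j) := by
    intro j hj
    have hjm : j ≤ m := by simpa [Nat.lt_succ_iff] using hj
    obtain ⟨c, rfl⟩ := Nat.exists_eq_add_of_le hjm
    rcases c with _ | c
    · simp [rootedForestCount]; ring
    · have h := Nat.add_one_mul_choose_eq (j + (c + 1)) j
      have e1 : j + (c + 1) + 1 - (j + 1) = c + 1 := by omega
      have e2 : j + (c + 1) - j = c + 1 := by omega
      have e3 : c + 1 + (j + 1) = j + (c + 1) + 1 := by omega
      simp only [rootedForestCount, e1, e2, e3, Nat.succ_ne_zero, if_false, Nat.add_sub_cancel]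
      calc _ = ((j + (c + 1) + 1).choose (j + 1) * (j + 1)) * r ^ (j + 1) *
                (j + (c + 1) + 1) ^ c := by ring
        _ = _ := by rw [← h]; ring
  rw [Finset.sum_congr rfl key, ← Finset.mul_sum]
  have h := add_pow r (m + 1) m
  simp only [Nat.cast_id] at h
  rw [← h]
  simp [rootedForestCount]
  left
  ring

theorem sum_finset_rootedForestCount {ι : Type} [Fintype ι] [Nonempty ι] (r : ℕ) :
    ∑ K : Finset ι, r ^ K.card * rootedForestCount (Fintype.card ι - K.card) K.card =
      rootedForestCount (Fintype.card ι) r := by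
  obtain ⟨m, hm⟩ := Nat.exists_eq_succ_of_ne_zero (Fintype.card_ne_zero (α := ι))
  rw [← Finset.powerset_univ, Finset.sum_powerset_apply_card
    (fun k => r ^ k * rootedForestCount (Fintype.card ι - k) k), Finset.card_univ, hm]
  simpa using sum_choose_mul_rootedForestCount m r

theorem pi_forall_exists_dist_lt_le {E ι R : Type} [PseudoMetricSpace E] [MeasurableSpace E]
    [Fintype ι] [Fintype R] {μ : Measure E} [SigmaFinite μ] {t : ℝ} {M : ENNReal}
    (hM : ∀ y, μ (ball y t) ≤ M) (y : R → E) :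
    Measure.pi (fun _ : ι => μ) {x | ∀ i, ∃ r, dist (x i) (y r) < t} ≤
      (Fintype.card R * M) ^ Fintype.card ι := by
  have hset : {x : ι → E | ∀ i, ∃ r, dist (x i) (y r) < t} =
      Set.univ.pi fun _ => ⋃ r, ball (y r) t := by
    ext x; simp
  have hU : μ (⋃ r, ball (y r) t) ≤ Fintype.card R * M :=
    (measure_iUnion_fintype_le μ _).trans <| by
      simpa using Finset.sum_le_sum fun r (_ : r ∈ Finset.univ) => hM (y r)
  rw [hset, Measure.pi_pi, Finset.prod_const, Finset.card_univ]
  gcongr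

theorem pi_joinedToRoots_le {E : Type} [PseudoMetricSpace E] [SecondCountableTopology E]
    [MeasurableSpace E] [BorelSpace E] {μ : Measure E} [IsProbabilityMeasure μ] {t : ℝ}
    {M : ENNReal} (hM : ∀ y, μ (ball y t) ≤ M) {ι R : Type} [Fintype ι] [Fintype R] (y : R → E) :
    Measure.pi (fun _ : ι => μ) {x | JoinedToRoots t y x} ≤
      rootedForestCount (Fintype.card ι) (Fintype.card R) * M ^ Fintype.card ι := by
  classical
  induction hn : Fintype.card ι using Nat.strong_induction_on generalizing ι R with
  | _ n ih =>
  rcases isEmpty_or_nonempty ι with hι | hι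
  · have : n = 0 := by rw [← hn]; exact Fintype.card_eq_zero
    subst this
    simpa [rootedForestCount] using prob_le_one
  subst hn
  let S : Finset ι → Set (ι → E) := fun K => {x | (∀ i : {i // i ∈ K}, ∃ r, dist (x i) (y r) < t) ∧
    JoinedToRoots t (fun i : {i // i ∈ K} => x i) (fun i : {i // i ∉ K} => x i)}
  have hsub : {x | JoinedToRoots t y x} ⊆ ⋃ K : Finset ι, S K := by
    intro x hx
    let K : Finset ι := Finset.univ.filter fun i => ∃ r, dist (x i) (y r) < t
    have hK : ∀ i, i ∈ K ↔ ∃ r, dist (x i) (y r) < t := fun i => by simp [K]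
    exact Set.mem_iUnion.2 ⟨K, fun i => (hK i).1 i.2, hx.restrict hK⟩
  have hS : ∀ K : Finset ι, Measure.pi (fun _ : ι => μ) (S K) ≤
      ((Fintype.card R ^ K.card * rootedForestCount (Fintype.card ι - K.card) K.card : ℕ) :
        ENNReal) * M ^ Fintype.card ι := by
    intro K
    rcases K.eq_empty_or_nonempty with rfl | hKne
    · have : S ∅ = ∅ := by
        ext x
        simp only [S, Set.mem_ofPred_eq, Set.mem_empty_iff_false, iff_false, not_and]
        intro _ h
        have i₀ : {i : ι // i ∉ (∅ : Finset ι)} := ⟨Classical.arbitrary ι, by simp⟩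
        obtain ⟨i, -, ⟨r, -⟩ | ⟨j, hj, -⟩⟩ := h Finset.univ ⟨i₀, Finset.mem_univ _⟩
        · exact absurd r.2 (Finset.notMem_empty _)
        · simp at hj
      rw [this]; simp
    have hcompl : Fintype.card {i // i ∉ K} = Fintype.card ι - K.card := by
      rw [Fintype.card_subtype_compl]; simp
    have hKle : K.card ≤ Fintype.card ι := K.card_le_univ
    let N : Set ({i // i ∈ K} → E) := {a | ∀ i, ∃ r, dist (a i) (y r) < t}
    have hN : MeasurableSet N := by
      refine IsOpen.measurableSet ?_
      simp only [N, Set.ofPred_forall, Set.ofPred_exists]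
      exact isOpen_iInter_of_finite fun i => isOpen_iUnion fun r =>
        isOpen_lt (by fun_prop) continuous_const
    let T : Set (({i // i ∈ K} → E) × ({i // i ∉ K} → E)) :=
      {q | q.1 ∈ N ∧ JoinedToRoots t q.1 q.2}
    have hT : MeasurableSet T :=
      (measurable_fst hN).inter (isOpen_joinedToRoots t).measurableSet
    have hpre : S K = MeasurableEquiv.piEquivPiSubtypeProd (fun _ : ι => E) (· ∈ K) ⁻¹' T := rfl
    have hmp : MeasurePreserving (MeasurableEquiv.piEquivPiSubtypeProd (fun _ : ι => E) (· ∈ K))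
        (Measure.pi fun _ => μ) ((Measure.pi fun _ => μ).prod (Measure.pi fun _ => μ)) := by
      convert measurePreserving_piEquivPiSubtypeProd (fun _ : ι => μ) (· ∈ K)
    rw [hpre, hmp.measure_preimage hT.nullMeasurableSet, Measure.prod_apply hT]
    calc _ ≤ ∫⁻ a, N.indicator (fun _ => (rootedForestCount (Fintype.card ι - K.card) K.card :
              ENNReal) * M ^ (Fintype.card ι - K.card)) a
              ∂Measure.pi (fun _ : {i // i ∈ K} => μ) := by
          refine lintegral_mono fun a => ?_
          by_cases ha : a ∈ N
          · rw [Set.indicator_of_mem ha]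
            have := ih (Fintype.card ι - K.card) (Nat.sub_lt Fintype.card_pos hKne.card_pos)
              (ι := {i // i ∉ K}) a hcompl
            rw [Fintype.card_coe] at this
            exact (measure_mono fun b hb => hb.2).trans this
          · have : Prod.mk a ⁻¹' T = ∅ := by
              ext b; simp [T, ha]
            simp [this]
      _ ≤ (rootedForestCount (Fintype.card ι - K.card) K.card : ENNReal) *
            M ^ (Fintype.card ι - K.card) * (Fintype.card R * M) ^ K.card := by
          rw [lintegral_indicator_const hN]
          gcongr
          exact (pi_forall_exists_dist_lt_le (ι := {i // i ∈ K}) hM y).trans_eq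
            (by rw [Fintype.card_coe])
      _ = _ := by
          conv_rhs => rw [← Nat.sub_add_cancel hKle, pow_add]
          rw [Nat.sub_add_cancel hKle]
          push_cast
          ring
  calc _ ≤ ∑ K : Finset ι, Measure.pi (fun _ : ι => μ) (S K) :=
        (measure_mono hsub).trans (measure_iUnion_fintype_le _ _)
    _ ≤ _ := Finset.sum_le_sum fun K _ => hS K
    _ = _ := by rw [← Finset.sum_mul, ← Nat.cast_sum, sum_finset_rootedForestCount]

theorem exists_dist_lt_of_maxSep_lt {p d : ℕ} {t : ℝ} {x : Fin p → EuclideanSpace ℝ (Fin d)}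
    (h : maxSep x < t) {S : Finset (Fin p)} (hS : S.Nonempty) (hS' : Sᶜ.Nonempty) :
    ∃ i ∈ S, ∃ j ∉ S, dist (x i) (x j) < t := by
  have hfin : {r : ℝ | ∃ S : Finset (Fin p), S.Nonempty ∧ Sᶜ.Nonempty ∧
      r = sInf {s : ℝ | ∃ i ∈ S, ∃ j ∈ Sᶜ, s = dist (x i) (x j)}}.Finite := by
    refine (Set.finite_range fun S : Finset (Fin p) =>
      sInf {s : ℝ | ∃ i ∈ S, ∃ j ∈ Sᶜ, s = dist (x i) (x j)}).subset ?_
    rintro r ⟨S, -, -, rfl⟩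
    exact ⟨S, rfl⟩
  obtain ⟨i₀, hi₀⟩ := hS
  obtain ⟨j₀, hj₀⟩ := hS'
  have hle : sInf {s : ℝ | ∃ i ∈ S, ∃ j ∈ Sᶜ, s = dist (x i) (x j)} ≤ maxSep x :=
    le_csSup hfin.bddAbove ⟨S, ⟨i₀, hi₀⟩, ⟨j₀, hj₀⟩, rfl⟩
  obtain ⟨_, ⟨i, hi, j, hj, rfl⟩, hd⟩ :=
    exists_lt_of_csInf_lt (by exact ⟨_, i₀, hi₀, j₀, hj₀, rfl⟩) (hle.trans_lt h)
  exact ⟨i, hi, j, by simpa using hj, hd⟩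

theorem joinedToRoots_of_maxSep_lt {n d : ℕ} {t : ℝ}
    {x : Fin (n + 1) → EuclideanSpace ℝ (Fin d)} (h : maxSep x < t) :
    JoinedToRoots t (fun _ : Unit => x 0) (fun i : Fin n => x i.succ) := by
  intro A hA
  obtain ⟨i, hi, j, hj, hd⟩ := exists_dist_lt_of_maxSep_lt h
    (S := A.map (Fin.succEmb n)) (by simpa using hA) ⟨0, by simp [Fin.succ_ne_zero]⟩
  obtain ⟨i, hiA, rfl⟩ := Finset.mem_map.1 hi
  refine ⟨i, hiA, ?_⟩
  rcases Fin.eq_zero_or_eq_succ j with rfl | ⟨j, rfl⟩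
  · exact Or.inl ⟨(), hd⟩
  · exact Or.inr ⟨j, fun hjA => hj (Finset.mem_map.2 ⟨j, hjA, rfl⟩), hd⟩

theorem pi_maxSep_lt_le {n d : ℕ} {μ : Measure (EuclideanSpace ℝ (Fin d))}
    [IsProbabilityMeasure μ] {t : ℝ} {M : ENNReal} (hM : ∀ y, μ (ball y t) ≤ M) :
    Measure.pi (fun _ : Fin (n + 1) => μ) {x | maxSep x < t} ≤ rootedForestCount n 1 * M ^ n := by
  let T : Set (EuclideanSpace ℝ (Fin d) × (Fin n → EuclideanSpace ℝ (Fin d))) :=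
    {q | JoinedToRoots t (fun _ : Unit => q.1) q.2}
  have hT : MeasurableSet T := by
    have hc : Continuous fun q : EuclideanSpace ℝ (Fin d) × (Fin n → EuclideanSpace ℝ (Fin d)) =>
        ((fun _ => q.1, q.2) : (Unit → EuclideanSpace ℝ (Fin d)) × _) := by fun_prop
    exact ((isOpen_joinedToRoots t).preimage hc).measurableSet
  calc _ ≤ Measure.pi (fun _ : Fin (n + 1) => μ)
          (MeasurableEquiv.piFinSuccAbove (fun _ => EuclideanSpace ℝ (Fin d)) 0 ⁻¹' T) :=
        measure_mono fun x hx => joinedToRoots_of_maxSep_lt hx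
    _ = ∫⁻ a, Measure.pi (fun _ : Fin n => μ) (Prod.mk a ⁻¹' T) ∂μ := by
        rw [(measurePreserving_piFinSuccAbove (fun _ : Fin (n + 1) => μ) 0).measure_preimage
          hT.nullMeasurableSet, Measure.prod_apply hT]
    _ ≤ ∫⁻ _, rootedForestCount n 1 * M ^ n ∂μ := lintegral_mono fun a =>
        (pi_joinedToRoots_le (ι := Fin n) hM (fun _ : Unit => a)).trans_eq (by simp)
    _ = _ := by simp

theorem pi_withDensity_ofReal {ι E : Type} [Fintype ι] [MeasurableSpace E] {ν : Measure E}
    [SigmaFinite ν] {f : E → ℝ} (hf : Integrable f ν) (hf0 : ∀ z, 0 ≤ f z) :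
    Measure.pi (fun _ : ι => ν.withDensity fun z => ENNReal.ofReal (f z)) =
      (Measure.pi fun _ : ι => ν).withDensity fun x => ENNReal.ofReal (∏ i, f (x i)) := by
  refine Measure.pi_eq fun s hs => ?_
  have hint : ∀ i, IntegrableOn f (s i) ν := fun i => hf.integrableOn
  rw [withDensity_apply _ (MeasurableSet.univ_pi hs), Measure.restrict_pi_pi,
    ← ofReal_integral_eq_lintegral_ofReal (Integrable.fintype_prod fun i => hint i)
      (Filter.Eventually.of_forall fun x => Finset.prod_nonneg fun i _ => hf0 _),
    integral_fintype_prod_eq_prod,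
    ENNReal.ofReal_prod_of_nonneg fun i _ => integral_nonneg hf0]
  refine Finset.prod_congr rfl fun i _ => ?_
  rw [withDensity_apply _ (hs i), ← ofReal_integral_eq_lintegral_ofReal (hint i)
    (Filter.Eventually.of_forall hf0)]

/-- For `d ≥ 1`, `p ≥ 2`, `t > 0` and a bounded probability density `κ` on `ℝ^d`,
`∫_{{δ(x) < t}} κ(x_1)⋯κ(x_p) dx ≤ p^{p−2} t^{(p−1)d} V_d^{p−1} ‖κ‖_∞^{p−1}`,
where `V_d` is the volume of the unit ball of `ℝ^d` and `‖κ‖_∞` the essential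
supremum of `κ`. -/
theorem stmt12 (d p : ℕ) (hd : 1 ≤ d) (hp : 2 ≤ p) (t : ℝ) (ht : 0 < t)
    (κ : EuclideanSpace ℝ (Fin d) → ℝ) (hκ0 : ∀ z, 0 ≤ κ z) (hκmeas : Measurable κ)
    (hκbdd : ∃ C : ℝ, ∀ z, κ z ≤ C) (hκint : ∫ z, κ z = 1) :
    ∫ x in {x : Fin p → EuclideanSpace ℝ (Fin d) | maxSep x < t}, ∏ i, κ (x i)
      ≤ (p : ℝ) ^ (p - 2) * t ^ ((p - 1) * d) *
          ((volume (ball (0 : EuclideanSpace ℝ (Fin d)) 1)).toReal) ^ (p - 1) *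
          (essSup κ volume) ^ (p - 1) := by
  obtain ⟨C, hC⟩ := hκbdd
  obtain ⟨m, rfl⟩ := Nat.exists_eq_add_of_le' hp
  have hint : Integrable κ := by
    by_contra h
    simp [integral_undef h] at hκint
  let μ : Measure (EuclideanSpace ℝ (Fin d)) :=
    volume.withDensity fun z => ENNReal.ofReal (κ z)
  have hμ : IsProbabilityMeasure μ := ⟨by
    rw [withDensity_apply _ MeasurableSet.univ, Measure.restrict_univ,
      ← ofReal_integral_eq_lintegral_ofReal hint (Filter.Eventually.of_forall hκ0), hκint,
      ENNReal.ofReal_one]⟩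
  have hle : ∀ᵐ z, κ z ≤ essSup κ volume :=
    ae_le_essSup (Filter.isBoundedUnder_of ⟨C, hC⟩)
  have hess0 : 0 ≤ essSup κ volume := by
    obtain ⟨z, hz⟩ := hle.exists
    exact (hκ0 z).trans hz
  set V := (volume (ball (0 : EuclideanSpace ℝ (Fin d)) 1)).toReal with hV
  have hV0 : 0 ≤ V := ENNReal.toReal_nonneg
  have hM : ∀ y, μ (ball y t) ≤ ENNReal.ofReal (essSup κ volume * (t ^ d * V)) := by
    intro y
    rw [withDensity_apply _ measurableSet_ball]
    calc _ ≤ ∫⁻ _ in ball y t, ENNReal.ofReal (essSup κ volume) :=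
          lintegral_mono_ae <| ae_restrict_of_ae <| hle.mono fun z hz => ENNReal.ofReal_le_ofReal hz
      _ = _ := by
          rw [setLIntegral_const, Measure.addHaar_ball_of_pos _ _ ht, finrank_euclideanSpace_fin,
            ENNReal.ofReal_mul hess0, ENNReal.ofReal_mul (by positivity), hV,
            ENNReal.ofReal_toReal measure_ball_lt_top.ne]
  have hmain := pi_maxSep_lt_le (n := m + 1) hM
  have hbound : 0 ≤ ((m + 2 : ℕ) : ℝ) ^ m * (essSup κ volume * (t ^ d * V)) ^ (m + 1) := by
    positivity
  have hlint : ∫⁻ x in {x : Fin (m + 2) → EuclideanSpace ℝ (Fin d) | maxSep x < t},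
      ENNReal.ofReal (∏ i, κ (x i)) ≤
      ENNReal.ofReal (((m + 2 : ℕ) : ℝ) ^ m * (essSup κ volume * (t ^ d * V)) ^ (m + 1)) := by
    rw [pi_withDensity_ofReal hint hκ0, withDensity_apply' _ _] at hmain
    refine hmain.trans_eq ?_
    rw [ENNReal.ofReal_mul (p := ((m + 2 : ℕ) : ℝ) ^ m) (by positivity),
      ENNReal.ofReal_pow (p := ((m + 2 : ℕ) : ℝ)) (by positivity),
      ENNReal.ofReal_pow (p := essSup κ volume * (t ^ d * V)) (by positivity),
      ENNReal.ofReal_natCast]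
    simp [rootedForestCount, add_assoc, one_add_one_eq_two]
  have hprod : Measurable fun x : Fin (m + 2) → EuclideanSpace ℝ (Fin d) => ∏ i, κ (x i) :=
    Finset.measurable_prod _ fun i _ => hκmeas.comp (measurable_pi_apply i)
  rw [integral_eq_lintegral_of_nonneg_ae
    (Filter.Eventually.of_forall fun x => Finset.prod_nonneg fun i _ => hκ0 _)
    hprod.aestronglyMeasurable]
  refine (ENNReal.toReal_le_of_le_ofReal hbound hlint).trans_eq ?_
  simp only [Nat.add_sub_cancel, show m + 2 - 1 = m + 1 from rfl]
  rw [mul_pow, mul_pow, ← pow_mul, mul_comm d]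
  ring
end

section
/- Let d ≥ 1, p ≥ 2, β > 0, λ > 0 and let κ : ℝ^d → [0,∞) be a bounded probability density (∫_{ℝ^d} κ(x) dx = 1). Then ∫_{(ℝ^d)^p} exp(−β δ(x) λ^{1/d}) κ(x_1)⋯κ(x_p) dx ≤ p^{p−2} V_d^{p−1} ‖κ‖_∞^{p−1} [(p−1)d]! / (β^{(p−1)d} λ^{p−1}), where V_d is the Lebesgue measure of the unit ball in ℝ^d and ‖κ‖_∞ is the essential supremum of κ. -/
open MeasureTheory Metric

section

open scoped ENNReal Finset

theorem sum_choose_mul_mul_pow (n k : ℕ) :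
    ∑ j ∈ Finset.range (n + 2), (n + 1).choose j * (j * k ^ j * (n + 1) ^ (n + 1 - j))
      = (n + 1) * (k * (k + (n + 1)) ^ n) := by
  rw [Finset.sum_range_succ', add_pow k, Finset.mul_sum, Finset.mul_sum, zero_mul, zero_mul,
    mul_zero, add_zero]
  refine Finset.sum_congr rfl fun j _ ↦ ?_
  have h : (n + 1).choose (j + 1) * (j + 1) = (n + 1) * n.choose j :=
    (Nat.add_one_mul_choose_eq n j).symm
  rw [Nat.add_sub_add_right]
  calc _ = ((n + 1).choose (j + 1) * (j + 1)) * (k ^ (j + 1) * (n + 1) ^ (n - j)) := by ring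
    _ = _ := by rw [h]; push_cast; ring

section Product

variable {ι : Type*} [DecidableEq ι] {X : ι → Type*} [∀ i, MeasurableSpace (X i)]
  {μ : ∀ i, Measure (X i)} [∀ i, SigmaFinite (μ i)]

theorem lmarginal_prod_eq (s : Finset ι) {g : ∀ i, X i → ℝ≥0∞} (hg : ∀ i, Measurable (g i))
    (x : ∀ i, X i) :
    lmarginal μ s (fun y ↦ ∏ i ∈ s, g i (y i)) x = ∏ i ∈ s, ∫⁻ z, g i z ∂μ i := by
  induction s using Finset.induction_on generalizing x with
  | empty => simp
  | insert a s ha ih =>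
    rw [lmarginal_insert' _ (by fun_prop) ha, lmarginal]
    simp only [Finset.prod_insert ha, Function.update_self]
    have h (y : ∀ i, X i) (z : X a) :
        ∏ i ∈ s, g i (Function.update y a z i) = ∏ i ∈ s, g i (y i) :=
      Finset.prod_congr rfl fun i hi ↦ by
        rw [Function.update_of_ne (ne_of_mem_of_not_mem hi ha)]
    simp only [h]
    simp_rw [lintegral_mul_const _ (hg a)]
    rw [lintegral_const_mul _ (by fun_prop)]
    congr 1
    exact ih x

theorem lintegral_pi_prod_eq [Fintype ι] {g : ∀ i, X i → ℝ≥0∞} (hg : ∀ i, Measurable (g i)) :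
    ∫⁻ x, ∏ i, g i (x i) ∂Measure.pi μ = ∏ i, ∫⁻ z, g i z ∂μ i := by
  by_cases h : Nonempty (∀ i, X i)
  · obtain ⟨x⟩ := h
    rw [lintegral_eq_lmarginal_univ x, lmarginal_prod_eq _ hg]
  · obtain ⟨i, hi⟩ := not_forall.1 (mt Classical.nonempty_pi.2 h)
    rw [not_nonempty_iff] at h hi
    rw [lintegral_of_isEmpty, Finset.prod_eq_zero (Finset.mem_univ i) (lintegral_of_isEmpty _ _)]

theorem pi_withDensity_eq [Fintype ι] {g : ∀ i, X i → ℝ≥0∞} (hg : ∀ i, Measurable (g i))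
    [∀ i, SigmaFinite ((μ i).withDensity (g i))] :
    Measure.pi (fun i ↦ (μ i).withDensity (g i))
      = (Measure.pi μ).withDensity fun x ↦ ∏ i, g i (x i) := by
  refine Measure.pi_eq fun s hs ↦ ?_
  rw [withDensity_apply _ (MeasurableSet.univ_pi hs), Measure.restrict_pi_pi,
    lintegral_pi_prod_eq hg]
  exact Finset.prod_congr rfl fun i _ ↦ (withDensity_apply _ (hs i)).symm

end Product

theorem measurableSet_forall_mem_biUnion_closedBall {ι E : Type*}
    [PseudoMetricSpace E] [SecondCountableTopology E] [MeasurableSpace E]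
    [OpensMeasurableSpace E] (r : ℝ) (R J : Finset ι) :
    MeasurableSet {x : ι → E | ∀ j ∈ J, x j ∈ ⋃ i ∈ R, closedBall (x i) r} := by
  have : {x : ι → E | ∀ j ∈ J, x j ∈ ⋃ i ∈ R, closedBall (x i) r}
      = ⋂ j ∈ J, ⋃ i ∈ R, {x : ι → E | dist (x j) (x i) ≤ r} := by
    ext x
    simp only [Set.mem_ofPred_eq, Set.mem_iInter, Set.mem_iUnion, mem_closedBall]
  rw [this]
  refine Finset.measurableSet_biInter _ fun j _ ↦ Finset.measurableSet_biUnion _ fun i _ ↦ ?_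
  exact measurableSet_le (by fun_prop) (by fun_prop)

section Connectivity

variable {ι E : Type*} [DecidableEq ι] [PseudoMetricSpace E]

/-- In the graph joining points at distance at most `r`, every nonempty subset of `U` has an
edge leaving it inside `R ∪ U`: every vertex of `U` is connected to `R` within `R ∪ U`. -/
def ConnectedTo (r : ℝ) (R U : Finset ι) (x : ι → E) : Prop :=
  ∀ A ⊆ U, A.Nonempty → ∃ a ∈ A, ∃ b ∈ (R ∪ U) \ A, dist (x a) (x b) ≤ r

theorem ConnectedTo.congr {r : ℝ} {R U : Finset ι} {x y : ι → E} (h : ConnectedTo r R U x)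
    (hxy : ∀ i ∈ R ∪ U, x i = y i) : ConnectedTo r R U y := by
  intro A hA hne
  obtain ⟨a, ha, b, hb, hab⟩ := h A hA hne
  refine ⟨a, ha, b, hb, ?_⟩
  rwa [← hxy a (Finset.mem_union_right _ (hA ha)), ← hxy b (Finset.mem_sdiff.1 hb).1]

theorem ConnectedTo.exists_layer {r : ℝ} {R U : Finset ι} {x : ι → E} (h : ConnectedTo r R U x)
    (hU : U.Nonempty) : ∃ J ⊆ U, J.Nonempty ∧
      (∀ j ∈ J, x j ∈ ⋃ i ∈ R, closedBall (x i) r) ∧ ConnectedTo r J (U \ J) x := by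
  classical
  refine ⟨{j ∈ U | x j ∈ ⋃ i ∈ R, closedBall (x i) r}, Finset.filter_subset _ _, ?_,
    fun j hj ↦ (Finset.mem_filter.1 hj).2, ?_⟩
  · obtain ⟨a, ha, b, hb, hab⟩ := h U subset_rfl hU
    refine ⟨a, Finset.mem_filter.2 ⟨ha, Set.mem_biUnion (x := b) ?_ hab⟩⟩
    simp only [Finset.mem_sdiff, Finset.mem_union] at hb
    exact hb.1.resolve_right hb.2
  · intro A hA hne
    obtain ⟨a, ha, b, hb, hab⟩ := h A (hA.trans Finset.sdiff_subset) hne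
    refine ⟨a, ha, b, ?_, hab⟩
    have haU := hA ha
    simp only [Finset.mem_sdiff, Finset.mem_filter, not_and] at haU
    simp only [Finset.mem_sdiff, Finset.mem_union] at hb
    have hbR : b ∉ R := fun hR ↦ haU.2 haU.1 (Set.mem_biUnion hR hab)
    rw [Finset.union_sdiff_of_subset (Finset.filter_subset _ _)]
    exact Finset.mem_sdiff.2 ⟨hb.1.resolve_left hbR, hb.2⟩

variable [SecondCountableTopology E] [MeasurableSpace E] [OpensMeasurableSpace E]

theorem measurableSet_connectedTo (R U : Finset ι) :
    MeasurableSet {q : ℝ × (ι → E) | ConnectedTo q.1 R U q.2} := by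
  have : {q : ℝ × (ι → E) | ConnectedTo q.1 R U q.2}
      = ⋂ A ∈ {A ∈ U.powerset | A.Nonempty}, ⋃ a ∈ A, ⋃ b ∈ (R ∪ U) \ A,
        {q : ℝ × (ι → E) | dist (q.2 a) (q.2 b) ≤ q.1} := by
    ext q
    simp only [ConnectedTo, Set.mem_ofPred_eq, Set.mem_iInter, Set.mem_iUnion, Finset.mem_filter,
      Finset.mem_powerset, exists_prop, and_imp]
  rw [this]
  refine Finset.measurableSet_biInter _ fun A _ ↦ Finset.measurableSet_biUnion _ fun a _ ↦
    Finset.measurableSet_biUnion _ fun b _ ↦ ?_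
  exact measurableSet_le (by fun_prop) (by fun_prop)

theorem measurableSet_connectedTo_right (r : ℝ) (R U : Finset ι) :
    MeasurableSet {x : ι → E | ConnectedTo r R U x} :=
  measurable_prodMk_left (x := r) (measurableSet_connectedTo R U)

variable {ν : Measure E} [IsProbabilityMeasure ν]

theorem lmarginal_layer_le {r : ℝ} {a : ℝ≥0∞} (ha : ∀ y, ν (closedBall y r) ≤ a)
    {R J : Finset ι} (hRJ : Disjoint R J) (x : ι → E) :
    lmarginal (fun _ ↦ ν) J
      ({x : ι → E | ∀ j ∈ J, x j ∈ ⋃ i ∈ R, closedBall (x i) r}.indicator 1) x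
      ≤ (#R * a) ^ #J := by
  have hB : ν (⋃ i ∈ R, closedBall (x i) r) ≤ #R * a := by
    refine (measure_biUnion_finset_le _ _).trans ((Finset.sum_le_sum fun i _ ↦ ha (x i)).trans ?_)
    simp
  have hmeas : MeasurableSet (⋃ i ∈ R, closedBall (x i) r) :=
    Finset.measurableSet_biUnion _ fun i _ ↦ isClosed_closedBall.measurableSet
  calc _ = ∫⁻ y : J → E, (Set.univ.pi fun _ ↦ ⋃ i ∈ R, closedBall (x i) r).indicator 1 y
        ∂Measure.pi fun _ ↦ ν := by
        refine lintegral_congr fun y ↦ ?_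
        have hR : ∀ i ∈ R, Function.updateFinset x J y i = x i := fun i hi ↦ by
          simp [Function.updateFinset, Finset.disjoint_left.1 hRJ hi]
        have hset : (⋃ i ∈ R, closedBall (Function.updateFinset x J y i) r)
            = ⋃ i ∈ R, closedBall (x i) r :=
          Set.iUnion₂_congr fun i hi ↦ by rw [hR i hi]
        have : (∀ j ∈ J, Function.updateFinset x J y j
              ∈ ⋃ i ∈ R, closedBall (Function.updateFinset x J y i) r)
            ↔ y ∈ Set.univ.pi fun _ : J ↦ ⋃ i ∈ R, closedBall (x i) r := by
          rw [hset, Set.mem_univ_pi]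
          exact ⟨fun h j ↦ by simpa [Function.updateFinset] using h j j.2,
            fun h j hj ↦ by simpa [Function.updateFinset, hj] using h ⟨j, hj⟩⟩
        by_cases h : y ∈ Set.univ.pi fun _ : J ↦ ⋃ i ∈ R, closedBall (x i) r
        · rw [Set.indicator_of_mem h, Set.indicator_of_mem (Set.mem_ofPred.2 (this.2 h))]; rfl
        · rw [Set.indicator_of_notMem h,
            Set.indicator_of_notMem fun h' ↦ h (this.1 (Set.mem_ofPred.1 h'))]
    _ = ν (⋃ i ∈ R, closedBall (x i) r) ^ #J := by
        rw [lintegral_indicator_one (MeasurableSet.univ_pi fun _ ↦ hmeas), Measure.pi_pi]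
        simp
    _ ≤ _ := by gcongr

theorem lmarginal_connectedTo_le {r : ℝ} {a : ℝ≥0∞} (ha : ∀ y, ν (closedBall y r) ≤ a)
    (U R : Finset ι) (hRU : Disjoint R U) (x : ι → E) :
    (#R + #U : ℕ) * lmarginal (fun _ ↦ ν) U ({x | ConnectedTo r R U x}.indicator 1) x
      ≤ (#R * (#R + #U) ^ #U : ℕ) * a ^ #U := by
  induction U using Finset.strongInduction generalizing R x with
  | H U ih =>
  rcases U.eq_empty_or_nonempty with rfl | hU
  · simp only [Finset.card_empty, add_zero, pow_zero, mul_one, lmarginal_empty]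
    exact mul_le_of_le_one_right' (Set.indicator_le_self' (by simp) _)
  obtain ⟨n, hn⟩ : ∃ n, #U = n + 1 := Nat.exists_eq_add_one.2 hU.card_pos
  set S : Finset ι → Set (ι → E) := fun J ↦ {x | ∀ j ∈ J, x j ∈ ⋃ i ∈ R, closedBall (x i) r}
  set T : Finset ι → Set (ι → E) := fun J ↦ {x | ConnectedTo r J (U \ J) x}
  have hS (J) : MeasurableSet (S J) :=
    measurableSet_forall_mem_biUnion_closedBall _ _ _
  have hT (J) : MeasurableSet (T J) := measurableSet_connectedTo_right _ _ _
  have hterm (J) (hJU : J ⊆ U) (hJ : J.Nonempty) :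
      (#U : ℝ≥0∞) * lmarginal (fun _ ↦ ν) U ((S J).indicator 1 * (T J).indicator 1) x
        ≤ (#J * #R ^ #J * #U ^ (#U - #J) : ℕ) * a ^ #U := by
    have hRJ : Disjoint R J := hRU.mono_right hJU
    have hinner (y : ι → E) : lmarginal (fun _ ↦ ν) (U \ J)
        ((S J).indicator 1 * (T J).indicator 1) y
          = (S J).indicator 1 y * lmarginal (fun _ ↦ ν) (U \ J) ((T J).indicator 1) y := by
      rw [lmarginal, lmarginal, ← lintegral_const_mul]
      · refine lintegral_congr fun z ↦ ?_
        simp only [Pi.mul_apply]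
        congr 1
        have h1 : ∀ i ∉ U \ J, Function.updateFinset y (U \ J) z i = y i := fun i hi ↦ by
          simp [Function.updateFinset, hi]
        have hmem : Function.updateFinset y (U \ J) z ∈ S J ↔ y ∈ S J := by
          refine forall₂_congr fun j hj ↦ ?_
          have hset : (⋃ i ∈ R, closedBall (Function.updateFinset y (U \ J) z i) r)
              = ⋃ i ∈ R, closedBall (y i) r :=
            Set.iUnion₂_congr fun i hi ↦ by
              rw [h1 i fun h ↦ Finset.disjoint_left.1 hRU hi (Finset.mem_sdiff.1 h).1]
          rw [hset, h1 j fun h ↦ (Finset.mem_sdiff.1 h).2 hj]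
        by_cases h : y ∈ S J
        · rw [Set.indicator_of_mem h, Set.indicator_of_mem (hmem.2 h)]; rfl
        · rw [Set.indicator_of_notMem h, Set.indicator_of_notMem (mt hmem.1 h)]
      · exact (measurable_one.indicator (hT J)).comp measurable_updateFinset
    have hcard : #J + #(U \ J) = #U := by
      rw [add_comm]; exact Finset.card_sdiff_add_card_eq_card hJU
    have hcard' : #(U \ J) = #U - #J := by omega
    have hih (y : ι → E) : (#U : ℝ≥0∞) * lmarginal (fun _ ↦ ν) (U \ J) ((T J).indicator 1) y
        ≤ (#J * #U ^ (#U - #J) : ℕ) * a ^ (#U - #J) := by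
      have := ih (U \ J) (Finset.sdiff_ssubset hJU hJ) J Finset.disjoint_sdiff y
      rwa [hcard, hcard'] at this
    calc _ = lmarginal (fun _ ↦ ν) J (fun y ↦ (S J).indicator 1 y *
          (#U * lmarginal (fun _ ↦ ν) (U \ J) ((T J).indicator 1) y)) x := by
          conv_lhs => rw [← Finset.union_sdiff_of_subset hJU]
          have hm : Measurable ((S J).indicator 1 * (T J).indicator 1 : (ι → E) → ℝ≥0∞) :=
            (measurable_one.indicator (hS J)).mul (measurable_one.indicator (hT J))
          rw [lmarginal_union _ _ hm Finset.disjoint_sdiff, lmarginal, lmarginal,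
            ← lintegral_const_mul]
          · refine lintegral_congr fun z ↦ ?_
            rw [hinner, mul_left_comm, Finset.union_sdiff_of_subset hJU]
          · exact (hm.lmarginal _).comp measurable_updateFinset
      _ ≤ lmarginal (fun _ ↦ ν) J (fun y ↦ (S J).indicator 1 y *
          ((#J * #U ^ (#U - #J) : ℕ) * a ^ (#U - #J))) x :=
          lmarginal_mono (fun y ↦ mul_le_mul_right (hih y) _) x
      _ = lmarginal (fun _ ↦ ν) J ((S J).indicator 1) x *
          ((#J * #U ^ (#U - #J) : ℕ) * a ^ (#U - #J)) := by
          rw [lmarginal, lmarginal, lintegral_mul_const]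
          exact (measurable_one.indicator (hS J)).comp measurable_updateFinset
      _ ≤ (#R * a) ^ #J * ((#J * #U ^ (#U - #J) : ℕ) * a ^ (#U - #J)) := by
          gcongr
          exact lmarginal_layer_le ha hRJ x
      _ = _ := by
          have : a ^ #U = a ^ #J * a ^ (#U - #J) := by rw [← pow_add]; congr 1; omega
          rw [this]
          push_cast
          ring
  have hsum : {x | ConnectedTo r R U x}.indicator (1 : (ι → E) → ℝ≥0∞)
      ≤ fun y ↦ ∑ J ∈ U.powerset with J.Nonempty,
        ((S J).indicator 1 * (T J).indicator 1 : (ι → E) → ℝ≥0∞) y := by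
    refine Set.indicator_le fun y hy ↦ ?_
    obtain ⟨J, hJU, hJ, h1, h2⟩ := ConnectedTo.exists_layer hy hU
    refine le_trans ?_ (Finset.single_le_sum (fun _ _ ↦ zero_le)
      (Finset.mem_filter.2 ⟨Finset.mem_powerset.2 hJU, hJ⟩))
    rw [Pi.mul_apply, Set.indicator_of_mem (show y ∈ S J from h1),
      Set.indicator_of_mem (show y ∈ T J from h2)]
    simp
  have key : (#U : ℝ≥0∞) * lmarginal (fun _ ↦ ν) U ({x | ConnectedTo r R U x}.indicator 1) x
      ≤ #U * ((#R * (#R + #U) ^ n : ℕ) * a ^ #U) := by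
    calc _ ≤ (#U : ℝ≥0∞) * lmarginal (fun _ ↦ ν) U (fun y ↦ ∑ J ∈ U.powerset with J.Nonempty,
          ((S J).indicator 1 * (T J).indicator 1 : (ι → E) → ℝ≥0∞) y) x := by
          gcongr
          exact lmarginal_mono hsum x
      _ = ∑ J ∈ U.powerset with J.Nonempty, (#U : ℝ≥0∞) *
          lmarginal (fun _ ↦ ν) U ((S J).indicator 1 * (T J).indicator 1) x := by
          rw [← Finset.mul_sum, lmarginal, lintegral_finsetSum]
          · rfl
          · exact fun J _ ↦ (((measurable_one.indicator (hS J)).mul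
              (measurable_one.indicator (hT J)))).comp measurable_updateFinset
      _ ≤ ∑ J ∈ U.powerset with J.Nonempty,
          ((#J * #R ^ #J * #U ^ (#U - #J) : ℕ) : ℝ≥0∞) * a ^ #U :=
          Finset.sum_le_sum fun J hJ ↦ by
            rw [Finset.mem_filter, Finset.mem_powerset] at hJ
            exact hterm J hJ.1 hJ.2
      _ ≤ ∑ J ∈ U.powerset, ((#J * #R ^ #J * #U ^ (#U - #J) : ℕ) : ℝ≥0∞) * a ^ #U :=
          Finset.sum_le_sum_of_subset (Finset.filter_subset _ _)
      _ = _ := by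
          rw [← Finset.sum_mul, ← mul_assoc, ← Nat.cast_sum, ← Nat.cast_mul,
            Finset.sum_powerset_apply_card (fun j ↦ j * #R ^ j * #U ^ (#U - j)), hn]
          simp only [smul_eq_mul]
          rw [sum_choose_mul_mul_pow]
  have hU0 : (#U : ℝ≥0∞) ≠ 0 := by simpa using hU.ne_empty
  have key' := (ENNReal.mul_le_mul_iff_right hU0 (ENNReal.natCast_ne_top _)).1 key
  calc _ ≤ ((#R + #U : ℕ) : ℝ≥0∞) * ((#R * (#R + #U) ^ n : ℕ) * a ^ #U) := by gcongr
    _ = _ := by rw [← mul_assoc, ← Nat.cast_mul, hn]; congr 2; ring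

end Connectivity

theorem pi_connectedTo_le {ι E : Type*} [Fintype ι] [DecidableEq ι] [PseudoMetricSpace E]
    [SecondCountableTopology E] [MeasurableSpace E] [OpensMeasurableSpace E]
    {ν : Measure E} [IsProbabilityMeasure ν] {r : ℝ} {a : ℝ≥0∞}
    (ha : ∀ y, ν (closedBall y r) ≤ a) (i₀ : ι) (hι : 2 ≤ Fintype.card ι) :
    Measure.pi (fun _ : ι ↦ ν) {x | ConnectedTo r {i₀} {i₀}ᶜ x}
      ≤ (Fintype.card ι : ℝ≥0∞) ^ (Fintype.card ι - 2) * a ^ (Fintype.card ι - 1) := by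
  have hE : Nonempty E := nonempty_of_isProbabilityMeasure ν
  set p := Fintype.card ι
  have hcard : #({i₀}ᶜ : Finset ι) = p - 1 := by
    rw [Finset.card_compl, Finset.card_singleton]
  have hp0 : (p : ℝ≥0∞) ≠ 0 := by simp; omega
  have hbound (x : ι → E) : lmarginal (fun _ ↦ ν) {i₀}ᶜ
      ({x | ConnectedTo r {i₀} {i₀}ᶜ x}.indicator 1) x ≤ (p : ℝ≥0∞) ^ (p - 2) * a ^ (p - 1) := by
    have h := lmarginal_connectedTo_le ha {i₀}ᶜ {i₀} disjoint_compl_right x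
    rw [hcard, Finset.card_singleton, one_mul, show 1 + (p - 1) = p by omega] at h
    refine (ENNReal.mul_le_mul_iff_right hp0 (ENNReal.natCast_ne_top _)).1 (h.trans_eq ?_)
    rw [← mul_assoc, ← pow_succ', show p - 2 + 1 = p - 1 by omega, Nat.cast_pow]
  have hm := measurableSet_connectedTo_right (E := E) r {i₀} ({i₀}ᶜ : Finset ι)
  let x₀ : ι → E := fun _ ↦ hE.some
  rw [← lintegral_indicator_one hm, lintegral_eq_lmarginal_univ x₀, ← Finset.union_compl {i₀},
    lmarginal_union _ _ (measurable_one.indicator hm) disjoint_compl_right]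
  refine (lmarginal_mono hbound x₀).trans_eq ?_
  simp [lmarginal]

theorem maxSep_nonneg {p d : ℕ} (x : Fin p → EuclideanSpace ℝ (Fin d)) : 0 ≤ maxSep x := by
  refine Real.sSup_nonneg ?_
  rintro _ ⟨S, -, -, rfl⟩
  refine Real.sInf_nonneg ?_
  rintro _ ⟨i, -, j, -, rfl⟩
  exact dist_nonneg

theorem connectedTo_of_maxSep_le {p d : ℕ} {x : Fin p → EuclideanSpace ℝ (Fin d)} {r : ℝ}
    (h : maxSep x ≤ r) (i₀ : Fin p) : ConnectedTo r {i₀} {i₀}ᶜ x := by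
  intro A hA hne
  have hc : Aᶜ.Nonempty := ⟨i₀, Finset.mem_compl.2 fun h ↦ by simpa using hA h⟩
  set D : Set ℝ := {s : ℝ | ∃ i ∈ A, ∃ j ∈ Aᶜ, s = dist (x i) (x j)}
  have hDfin : D.Finite := by
    refine (Set.finite_range fun q : Fin p × Fin p ↦ dist (x q.1) (x q.2)).subset ?_
    rintro _ ⟨i, -, j, -, rfl⟩
    exact ⟨(i, j), rfl⟩
  have hDne : D.Nonempty := by
    obtain ⟨i, hi⟩ := hne
    obtain ⟨j, hj⟩ := hc
    exact ⟨_, i, hi, j, hj, rfl⟩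
  have hbdd : BddAbove {r : ℝ | ∃ S : Finset (Fin p), S.Nonempty ∧ Sᶜ.Nonempty ∧
      r = sInf {s : ℝ | ∃ i ∈ S, ∃ j ∈ Sᶜ, s = dist (x i) (x j)}} := by
    refine ((Set.finite_range fun S : Finset (Fin p) ↦
      sInf {s : ℝ | ∃ i ∈ S, ∃ j ∈ Sᶜ, s = dist (x i) (x j)}).subset ?_).bddAbove
    rintro _ ⟨S, -, -, rfl⟩
    exact ⟨S, rfl⟩
  have hle : sInf D ≤ maxSep x := le_csSup hbdd ⟨A, hne, hc, rfl⟩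
  obtain ⟨i, hi, j, hj, hij⟩ := hDne.csInf_mem hDfin
  refine ⟨i, hi, j, ?_, hij ▸ hle.trans h⟩
  rw [Finset.union_compl]
  exact Finset.mem_sdiff.2 ⟨Finset.mem_univ _, Finset.mem_compl.1 hj⟩

theorem ofReal_exp_neg_mul_eq_setLIntegral {b : ℝ} (hb : 0 < b) (c : ℝ) :
    ENNReal.ofReal (Real.exp (-(b * c)))
      = ∫⁻ r in Set.Ioi c, ENNReal.ofReal (b * Real.exp (-(b * r))) := by
  have h : ∫ r in Set.Ioi c, b * Real.exp (-(b * r)) = Real.exp (-(b * c)) := by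
    simp_rw [← neg_mul]
    rw [integral_const_mul, integral_exp_mul_Ioi (neg_neg_of_pos hb)]
    field_simp
  rw [← h, ofReal_integral_eq_lintegral_ofReal]
  · exact not_imp_comm.1 integral_undef (h ▸ (Real.exp_pos _).ne')
  · exact Filter.Eventually.of_forall fun r ↦ by positivity

theorem setLIntegral_exp_neg_mul_pow {b : ℝ} (hb : 0 < b) (n : ℕ) :
    ∫⁻ r in Set.Ioi 0, ENNReal.ofReal (b * Real.exp (-(b * r)) * r ^ n)
      = ENNReal.ofReal (n.factorial / b ^ n) := by
  have h : ∫ r in Set.Ioi 0, b * Real.exp (-(b * r)) * r ^ n = n.factorial / b ^ n := by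
    have h := Real.integral_rpow_mul_exp_neg_mul_Ioi (a := n + 1) (by positivity) hb
    simp only [add_sub_cancel_right, Real.rpow_natCast] at h
    rw [Real.Gamma_nat_eq_factorial, ← Nat.cast_add_one, Real.rpow_natCast] at h
    simp_rw [mul_assoc, mul_comm (Real.exp _)]
    rw [integral_const_mul, h, one_div, inv_pow, pow_succ']
    field_simp
  rw [← h, ofReal_integral_eq_lintegral_ofReal]
  · exact not_imp_comm.1 integral_undef (h ▸ by positivity)
  · refine (ae_restrict_iff' measurableSet_Ioi).2 (Filter.Eventually.of_forall fun r hr ↦ ?_)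
    have : 0 < r := hr
    positivity

theorem lintegral_exp_maxSep_le {d p : ℕ} (hp : 2 ≤ p) {b : ℝ} (hb : 0 < b)
    (ν : Measure (EuclideanSpace ℝ (Fin d))) [IsProbabilityMeasure ν] {K : ℝ} (hK : 0 ≤ K)
    (hν : ∀ y r, 0 ≤ r → ν (closedBall y r) ≤ ENNReal.ofReal (K * r ^ d))
    {g : (Fin p → EuclideanSpace ℝ (Fin d)) → ℝ≥0∞} (hg : Measurable g)
    (hpi : Measure.pi (fun _ ↦ ν) = volume.withDensity g) :
    ∫⁻ x, ENNReal.ofReal (Real.exp (-(b * maxSep x))) * g x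
      ≤ ENNReal.ofReal
        ((p : ℝ) ^ (p - 2) * K ^ (p - 1) * (((p - 1) * d).factorial / b ^ ((p - 1) * d))) := by
  let i₀ : Fin p := ⟨0, by omega⟩
  let C : Set (ℝ × (Fin p → EuclideanSpace ℝ (Fin d))) :=
    {q | ConnectedTo q.1 {i₀} {i₀}ᶜ q.2}
  have hC : MeasurableSet C := measurableSet_connectedTo _ _
  let e : ℝ → ℝ≥0∞ := fun r ↦ ENNReal.ofReal (b * Real.exp (-(b * r)))
  have he : Measurable e := by fun_prop
  let F : ℝ × (Fin p → EuclideanSpace ℝ (Fin d)) → ℝ≥0∞ := fun q ↦ e q.1 * C.indicator 1 q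
  have hF : Measurable F := (he.comp measurable_fst).mul (measurable_one.indicator hC)
  have hG : Measurable fun x ↦ ∫⁻ r in Set.Ioi 0, F (r, x) :=
    hF.lintegral_prod_left'
  have hexp (x : Fin p → EuclideanSpace ℝ (Fin d)) :
      ENNReal.ofReal (Real.exp (-(b * maxSep x))) ≤ ∫⁻ r in Set.Ioi 0, F (r, x) := by
    rw [ofReal_exp_neg_mul_eq_setLIntegral hb]
    calc _ ≤ ∫⁻ r in Set.Ioi (maxSep x), F (r, x) := by
          refine setLIntegral_mono' measurableSet_Ioi fun r hr ↦ ?_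
          have : (r, x) ∈ C := connectedTo_of_maxSep_le (le_of_lt hr) i₀
          simp [F, e, Set.indicator_of_mem this]
      _ ≤ _ := lintegral_mono_set (Set.Ioi_subset_Ioi (maxSep_nonneg x))
  calc _ ≤ ∫⁻ x, (∫⁻ r in Set.Ioi 0, F (r, x)) * g x := by
        gcongr with x
        exact hexp x
    _ = ∫⁻ x, (∫⁻ r in Set.Ioi 0, F (r, x)) ∂Measure.pi fun _ ↦ ν := by
        rw [hpi, lintegral_withDensity_eq_lintegral_mul _ hg hG]
        simp only [Pi.mul_apply, mul_comm]
    _ = ∫⁻ r in Set.Ioi 0, ∫⁻ x, F (r, x) ∂Measure.pi fun _ ↦ ν :=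
        lintegral_lintegral_swap (hF.comp measurable_swap).aemeasurable
    _ = ∫⁻ r in Set.Ioi 0, e r * Measure.pi (fun _ ↦ ν) {x | ConnectedTo r {i₀} {i₀}ᶜ x} := by
        refine lintegral_congr fun r ↦ ?_
        have hm := measurableSet_connectedTo_right (E := EuclideanSpace ℝ (Fin d)) r {i₀}
          ({i₀}ᶜ : Finset (Fin p))
        rw [← lintegral_indicator_one hm, ← lintegral_const_mul _ (measurable_one.indicator hm)]
        rfl
    _ ≤ ∫⁻ r in Set.Ioi 0, ENNReal.ofReal ((p : ℝ) ^ (p - 2) * K ^ (p - 1)) *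
        ENNReal.ofReal (b * Real.exp (-(b * r)) * r ^ ((p - 1) * d)) := by
        refine setLIntegral_mono' measurableSet_Ioi fun r hr ↦ ?_
        have hr0 : 0 < r := hr
        have h := pi_connectedTo_le (ν := ν) (fun y ↦ hν y r hr0.le) i₀ (by simpa using hp)
        rw [Fintype.card_fin] at h
        refine (mul_le_mul_right h (e r)).trans_eq ?_
        rw [← ENNReal.ofReal_natCast, ← ENNReal.ofReal_pow (by positivity),
          ← ENNReal.ofReal_pow (by positivity), ← ENNReal.ofReal_mul (by positivity),
          ← ENNReal.ofReal_mul (by positivity), ← ENNReal.ofReal_mul (by positivity)]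
        congr 1
        rw [mul_pow, ← pow_mul, mul_comm d]
        ring
    _ = _ := by
        rw [lintegral_const_mul _ (by fun_prop), setLIntegral_exp_neg_mul_pow hb,
          ← ENNReal.ofReal_mul (by positivity)]

end

/-- For `d ≥ 1`, `p ≥ 2`, `β > 0`, `λ > 0` and a bounded probability density `κ` on `ℝ^d`,
`∫_{(ℝ^d)^p} exp(−β δ(x) λ^{1/d}) κ(x_1)⋯κ(x_p) dx
  ≤ p^{p−2} V_d^{p−1} ‖κ‖_∞^{p−1} [(p−1)d]! / (β^{(p−1)d} λ^{p−1})`,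
where `V_d` is the volume of the unit ball of `ℝ^d` and `‖κ‖_∞` the essential
supremum of `κ`. -/
theorem stmt13 (d p : ℕ) (hd : 1 ≤ d) (hp : 2 ≤ p) (β lam : ℝ) (hβ : 0 < β)
    (hlam : 0 < lam)
    (κ : EuclideanSpace ℝ (Fin d) → ℝ) (hκ0 : ∀ z, 0 ≤ κ z) (hκmeas : Measurable κ)
    (hκbdd : ∃ C : ℝ, ∀ z, κ z ≤ C) (hκint : ∫ z, κ z = 1) :
    ∫ x : Fin p → EuclideanSpace ℝ (Fin d),
        Real.exp (-β * maxSep x * lam ^ ((1 : ℝ) / d)) * ∏ i, κ (x i)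
      ≤ (p : ℝ) ^ (p - 2) *
          ((volume (ball (0 : EuclideanSpace ℝ (Fin d)) 1)).toReal) ^ (p - 1) *
          (essSup κ volume) ^ (p - 1) * (Nat.factorial ((p - 1) * d) : ℝ) /
          (β ^ ((p - 1) * d) * lam ^ (p - 1)) := by
  have hd0 : (d : ℝ) ≠ 0 := by positivity
  have hint : Integrable κ := integrable_of_integral_eq_one hκint
  have hess : ∀ᵐ z, κ z ≤ essSup κ volume :=
    ae_le_essSup (hκbdd.elim fun C hC ↦ Filter.isBoundedUnder_of ⟨C, hC⟩)
  set M := essSup κ volume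
  set V := (volume (ball (0 : EuclideanSpace ℝ (Fin d)) 1)).toReal with hV
  have hM : 0 ≤ M := hess.exists.elim fun z hz ↦ (hκ0 z).trans hz
  have hV0 : 0 ≤ V := ENNReal.toReal_nonneg
  have hκm : Measurable fun z ↦ ENNReal.ofReal (κ z) := hκmeas.ennreal_ofReal
  set ν := (volume : Measure (EuclideanSpace ℝ (Fin d))).withDensity
    fun z ↦ ENNReal.ofReal (κ z)
  have hνprob : IsProbabilityMeasure ν := ⟨by
    rw [withDensity_apply _ MeasurableSet.univ, setLIntegral_univ,
      ← ofReal_integral_eq_lintegral_ofReal hint (Filter.Eventually.of_forall hκ0), hκint,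
      ENNReal.ofReal_one]⟩
  have hν (y : EuclideanSpace ℝ (Fin d)) (r : ℝ) (hr : 0 ≤ r) :
      ν (closedBall y r) ≤ ENNReal.ofReal (M * V * r ^ d) := by
    rw [withDensity_apply _ isClosed_closedBall.measurableSet]
    calc _ ≤ ∫⁻ _ in closedBall y r, ENNReal.ofReal M :=
          lintegral_mono_ae (ae_restrict_of_ae (hess.mono fun z hz ↦ ENNReal.ofReal_le_ofReal hz))
      _ = ENNReal.ofReal (M * V * r ^ d) := by
          rw [setLIntegral_const, Measure.addHaar_closedBall _ _ hr, finrank_euclideanSpace_fin,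
            ← ENNReal.ofReal_toReal (measure_ball_lt_top (x := (0 : EuclideanSpace ℝ (Fin d)))
              (r := 1) (μ := volume)).ne, ← hV, ← ENNReal.ofReal_mul (by positivity),
            ← ENNReal.ofReal_mul hM]
          congr 1
          ring
  set b := β * lam ^ ((1 : ℝ) / d) with hbdef
  have hb : 0 < b := by positivity
  have hbpow : b ^ ((p - 1) * d) = β ^ ((p - 1) * d) * lam ^ (p - 1) := by
    rw [hbdef, mul_pow]
    congr 1
    rw [mul_comm, pow_mul, ← Real.rpow_natCast _ d, ← Real.rpow_mul hlam.le,
      one_div_mul_cancel hd0, Real.rpow_one]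
  have hpi : Measure.pi (fun _ : Fin p ↦ ν)
      = volume.withDensity fun x ↦ ∏ i, ENNReal.ofReal (κ (x i)) := by
    have : SigmaFinite ν := inferInstance
    exact pi_withDensity_eq fun _ ↦ hκm
  have hmain := lintegral_exp_maxSep_le hp hb ν (mul_nonneg hM hV0) hν (by fun_prop) hpi
  have hrhs : (p : ℝ) ^ (p - 2) * V ^ (p - 1) * M ^ (p - 1) * (Nat.factorial ((p - 1) * d) : ℝ) /
      (β ^ ((p - 1) * d) * lam ^ (p - 1))
        = (p : ℝ) ^ (p - 2) * (M * V) ^ (p - 1) *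
          (((p - 1) * d).factorial / b ^ ((p - 1) * d)) := by
    rw [hbpow, mul_pow]
    ring
  rw [hrhs]
  by_cases hI : Integrable fun x : Fin p → EuclideanSpace ℝ (Fin d) ↦
      Real.exp (-β * maxSep x * lam ^ ((1 : ℝ) / d)) * ∏ i, κ (x i)
  · rw [← ENNReal.ofReal_le_ofReal_iff (by positivity), ofReal_integral_eq_lintegral_ofReal hI]
    · refine le_of_eq_of_le (lintegral_congr fun x ↦ ?_) hmain
      rw [ENNReal.ofReal_mul (by positivity), ENNReal.ofReal_prod_of_nonneg fun i _ ↦ hκ0 _, hbdef]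
      congr 3
      ring
    · exact Filter.Eventually.of_forall fun x ↦
        mul_nonneg (Real.exp_pos _).le (Finset.prod_nonneg fun i _ ↦ hκ0 _)
  · rw [integral_undef hI]
    positivity
end
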